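/- Let T be a complete first-order theory with infinite models in a countable language L such that T has strictly fewer than 2^ℵ₀ countably infinite models up to isomorphism, let M be an ℵ₁-saturated model of T, let p ∈ S₁(T), let < be a relatively ∅-definable linear order on p(M) (i.e., < equals p(M)² ∩ φ(M²) for some L-formula φ(x,y)), and let E be a relatively ∅-definable equivalence relation on p(M) which is convex (each E-class is a convex subset of (p(M),<)) and has infinitely many classes. Then the quotient linear order (p(M)/E, <) is dense and has neither a least nor a greatest element. -/

import Mathlib

open FirstOrder FirstOrder.Language Set Cardinal

universe u v w

namespace PaperDef

variable {L : FirstOrder.Language.{u, v}}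

/-- Valuation assigning parameters from `A` their own values and the
`n` free variables the values given by the tuple `x`. -/
def pval {M : Type w} {A : Set M} {n : ℕ} (x : Fin n → M) : ↥A ⊕ Fin n → M :=
  Sum.elim Subtype.val x

variable {M : Type w} [L.Structure M]

/-- The subset of `M` defined by an `L(A)`-formula in one free variable. -/
def defSet (A : Set M) (δ : L.Formula (↥A ⊕ Fin 1)) : Set M :=
  {a | δ.Realize (pval ![a])}

/-- The binary relation on `M` defined by an `L(A)`-formula in two free variables. -/
def defRel (A : Set M) (φ : L.Formula (↥A ⊕ Fin 2)) : M → M → Prop :=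
  fun a b => φ.Realize (pval ![a, b])

/-- The relation defined by `φ`, guarded so as to only hold on the set defined by `δ`
(the paper's convention of writing `x < y` for `x ∈ D ∧ y ∈ D ∧ x < y`). -/
def gRel (A : Set M) (δ : L.Formula (↥A ⊕ Fin 1)) (φ : L.Formula (↥A ⊕ Fin 2)) :
    M → M → Prop :=
  fun a b => a ∈ defSet A δ ∧ b ∈ defSet A δ ∧ defRel A φ a b

/-- The set of realizations in `M` of a set of `L(A)`-formulas in one free variable. -/
def typeSet (A : Set M) (p : Set (L.Formula (↥A ⊕ Fin 1))) : Set M :=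
  {a | ∀ φ ∈ p, φ.Realize (pval ![a])}

/-- A set of `L(A)`-formulas in `n` free variables is finitely satisfiable in `M`. -/
def FinSat (A : Set M) {n : ℕ} (p : Set (L.Formula (↥A ⊕ Fin n))) : Prop :=
  ∀ s : Finset (L.Formula (↥A ⊕ Fin n)), ↑s ⊆ p →
    ∃ x : Fin n → M, ∀ φ ∈ s, Formula.Realize φ (pval x)

/-- A complete `n`-type over `A` (relative to the complete theory of `M` with
parameters in `A`): a maximal finitely satisfiable set of formulas. -/
def IsCompleteType (A : Set M) {n : ℕ} (p : Set (L.Formula (↥A ⊕ Fin n))) : Prop :=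
  FinSat A p ∧ ∀ φ : L.Formula (↥A ⊕ Fin n), φ ∈ p ∨ BoundedFormula.not φ ∈ p

/-- `M` is ℵ₀-saturated: every finitely satisfiable set of formulas in one free
variable with parameters from a finite subset of `M` is realized in `M`. -/
def IsAleph0Saturated (L : FirstOrder.Language.{u, v}) (M : Type w) [L.Structure M] : Prop :=
  ∀ A : Set M, A.Finite → ∀ p : Set (L.Formula (↥A ⊕ Fin 1)),
    FinSat A p → (typeSet A p).Nonempty

/-- `M` is ℵ₁-saturated: every finitely satisfiable set of formulas in one free
variable with parameters from a countable subset of `M` is realized in `M`. -/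
def IsAleph1Saturated (L : FirstOrder.Language.{u, v}) (M : Type w) [L.Structure M] : Prop :=
  ∀ A : Set M, A.Countable → ∀ p : Set (L.Formula (↥A ⊕ Fin 1)),
    FinSat A p → (typeSet A p).Nonempty

/-- The definable closure of `A` in `M`. -/
def dclSet (L : FirstOrder.Language.{u, v}) {M : Type w} [L.Structure M] (A : Set M) : Set M :=
  {a | ∃ φ : L.Formula (↥A ⊕ Fin 1),
    φ.Realize (pval ![a]) ∧ ∀ b : M, φ.Realize (pval ![b]) → b = a}

/-- `r` is a (strict) linear order on the set `D`. -/
def IsLinearOn {X : Type*} (r : X → X → Prop) (D : Set X) : Prop :=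
  (∀ a ∈ D, ¬r a a) ∧
  (∀ a ∈ D, ∀ b ∈ D, ∀ c ∈ D, r a b → r b c → r a c) ∧
  (∀ a ∈ D, ∀ b ∈ D, a = b ∨ r a b ∨ r b a)

/-- The linear order `r` on `D` is discrete: every element other than the maximum
has an immediate successor and every element other than the minimum has an
immediate predecessor. -/
def IsDiscreteOn {X : Type*} (r : X → X → Prop) (D : Set X) : Prop :=
  (∀ a ∈ D, (∃ b ∈ D, r a b) → ∃ b ∈ D, r a b ∧ ∀ c ∈ D, r a c → c = b ∨ r b c) ∧
  (∀ a ∈ D, (∃ b ∈ D, r b a) → ∃ b ∈ D, r b a ∧ ∀ c ∈ D, r c a → c = b ∨ r c b)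

/-- `C` is an initial part of the order `(D, r)`. -/
def IsInitialPart {X : Type*} (r : X → X → Prop) (D C : Set X) : Prop :=
  C ⊆ D ∧ ∀ c ∈ C, ∀ d ∈ D, r d c → d ∈ C

/-- `(C, r)` has order type ω: `C` is infinite and every element has only
finitely many predecessors in `C`. -/
def HasOrderTypeOmega {X : Type*} (r : X → X → Prop) (C : Set X) : Prop :=
  C.Infinite ∧ ∀ c ∈ C, {c' ∈ C | r c' c}.Finite

/-- `p` is a simple type over `A`, witnessed by `C ⊆ dcl(A)` and the `A`-definable
linear order `(D, <)` given by the formulas `δ` (defining `D`) and `lt` (defining `<`). -/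
def IsSimpleWitness (A : Set M) (p : Set (L.Formula (↥A ⊕ Fin 1))) (C : Set M)
    (δ : L.Formula (↥A ⊕ Fin 1)) (lt : L.Formula (↥A ⊕ Fin 2)) : Prop :=
  IsCompleteType A p ∧
  C.Infinite ∧
  C ⊆ dclSet L A ∧
  IsLinearOn (gRel A δ lt) (defSet A δ) ∧
  IsInitialPart (gRel A δ lt) (defSet A δ) C ∧
  HasOrderTypeOmega (gRel A δ lt) C ∧
  ∀ φ : L.Formula (↥A ⊕ Fin 1),
    φ ∈ p ↔ {c ∈ C | ¬φ.Realize (pval ![c])}.Finite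

/-- `b` is the immediate successor of `a` in the order `(P, r)`. -/
def SuccIn {X : Type*} (r : X → X → Prop) (P : Set X) (a b : X) : Prop :=
  a ∈ P ∧ b ∈ P ∧ r a b ∧ ∀ c ∈ P, r a c → c = b ∨ r b c

/-- `zIter S k a b` says that `b = Sᵏ(a)`, where negative iterates of `S` are
interpreted via the (partial) inverse of `S`. -/
def zIter {X : Type*} (S : X → X) (k : ℤ) (a b : X) : Prop :=
  if 0 ≤ k then S^[k.toNat] a = b else S^[(-k).toNat] b = a

/-- Isomorphism as an equivalence relation on countably infinite models of `T`
(with underlying set in `Type 0`). -/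
def countableModelSetoid (T : L.Theory) :
    Setoid {N : Theory.ModelType.{u, v, 0} T // Countable N ∧ Infinite N} where
  r N₁ N₂ := Nonempty (N₁.1 ≃[L] N₂.1)
  iseqv := ⟨fun N => ⟨FirstOrder.Language.Equiv.refl L N.1⟩,
    fun e => e.map FirstOrder.Language.Equiv.symm,
    fun e f => Nonempty.map2 (fun i j => j.comp i) e f⟩

/-- The number of countably infinite models of `T` up to isomorphism. -/
noncomputable def numCountableModels (T : L.Theory) : Cardinal :=
  #(Quotient (countableModelSetoid T))

universe w'

/-- An abstract system of definable predicates on a type. -/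
structure DefSystem (Y : Type w) where
  Def : ∀ {α : Type}, ((α → Y) → Prop) → Prop
  not' : ∀ {α : Type} {P : (α → Y) → Prop}, Def P → Def (fun v => ¬ P v)
  and' : ∀ {α : Type} {P Q : (α → Y) → Prop}, Def P → Def Q → Def (fun v => P v ∧ Q v)
  rel' : ∀ {α β : Type} (g : α → β) {P : (α → Y) → Prop}, Def P →
    Def (fun v : β → Y => P (fun i => v (g i)))
  exs' : ∀ {α β : Type} {P : (α ⊕ β → Y) → Prop}, Def P →
    Def (fun v : β → Y => ∃ u : α → Y, P (Sum.elim u v))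
  eq' : Def (fun v : Bool → Y => v false = v true)
  supp' : ∀ {α : Type} {P : (α → Y) → Prop}, Def P →
    ∃ F : Finset α, ∀ u v : α → Y, (∀ i ∈ F, u i = v i) → (P u ↔ P v)
  countable' : ∀ (α : Type) [Countable α], {P : (α → Y) → Prop | Def P}.Countable
  sat' : ∀ {α β : Type} [Countable α] [Countable β] (S : Set ((α ⊕ β → Y) → Prop)),
    (∀ P ∈ S, Def P) → ∀ b : β → Y,
    (∀ s : Finset ((α ⊕ β → Y) → Prop), ↑s ⊆ S → ∃ u : α → Y, ∀ P ∈ s, P (Sum.elim u b)) →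
    ∃ u : α → Y, ∀ P ∈ S, P (Sum.elim u b)

namespace DefSystem

variable {Y : Type w} (D : DefSystem Y) {α β γ : Type}

theorem congr {P Q : (α → Y) → Prop} (hP : D.Def P) (h : ∀ v, P v ↔ Q v) : D.Def Q := by
  have : P = Q := funext fun v => propext (h v)
  exact this ▸ hP

theorem or {P Q : (α → Y) → Prop} (hP : D.Def P) (hQ : D.Def Q) :
    D.Def (fun v => P v ∨ Q v) :=
  D.congr (D.not' (D.and' (D.not' hP) (D.not' hQ))) (fun v => by tauto)

theorem imp {P Q : (α → Y) → Prop} (hP : D.Def P) (hQ : D.Def Q) :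
    D.Def (fun v => P v → Q v) :=
  D.congr (D.not' (D.and' hP (D.not' hQ))) (fun v => by tauto)

theorem iff {P Q : (α → Y) → Prop} (hP : D.Def P) (hQ : D.Def Q) :
    D.Def (fun v => P v ↔ Q v) :=
  D.congr (D.and' (D.imp hP hQ) (D.imp hQ hP)) (fun v => by tauto)

theorem tt [Nonempty α] : D.Def (fun _ : α → Y => True) := by
  obtain ⟨i⟩ := ‹Nonempty α›
  exact D.congr (D.rel' (fun _ : Bool => i) D.eq') (fun v => by simp)

theorem tt' : D.Def (fun _ : α → Y => True) := by
  have h : D.Def (fun _ : Unit ⊕ α → Y => True) := D.tt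
  by_cases hY : Nonempty Y
  · obtain ⟨y⟩ := hY
    exact D.congr (D.exs' h) (fun v => ⟨fun _ => trivial, fun _ => ⟨fun _ => y, trivial⟩⟩)
  · have h2 := D.not' (D.exs' h)
    refine D.congr h2 (fun v => ?_)
    simp only [iff_true]
    rintro ⟨u, -⟩
    exact hY ⟨u ()⟩

theorem fin_all {ι : Type*} (F : Finset ι) {P : ι → (α → Y) → Prop}
    (h : ∀ i ∈ F, D.Def (P i)) : D.Def (fun v => ∀ i ∈ F, P i v) := by
  classical
  induction F using Finset.induction_on with
  | empty => exact D.congr D.tt' (fun v => by simp)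
  | insert a s ha ih =>
    refine D.congr (D.and' (h a (by simp)) (ih fun i hi => h i (by simp [hi]))) (fun v => ?_)
    simp

theorem finite_all {ι : Type*} [Finite ι] {P : ι → (α → Y) → Prop}
    (h : ∀ i, D.Def (P i)) : D.Def (fun v => ∀ i, P i v) := by
  have := Fintype.ofFinite ι
  exact D.congr (D.fin_all Finset.univ (fun i _ => h i)) (fun v => by simp)

/-- Definable unary predicates. -/
def Def1 (B : Y → Prop) : Prop := D.Def (fun v : Unit → Y => B (v ()))
/-- Definable binary predicates. -/
def Def2 (P : Y → Y → Prop) : Prop := D.Def (fun v : Bool → Y => P (v false) (v true))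
/-- Definable predicates in one variable and a tuple. -/
def DefO (P : Y → (β → Y) → Prop) : Prop :=
  D.Def (fun w : Option β → Y => P (w none) (fun i => w (some i)))
/-- Definable predicates in two tuples. -/
def DefS (P : (α → Y) → (β → Y) → Prop) : Prop :=
  D.Def (fun w : α ⊕ β → Y => P (fun i => w (Sum.inl i)) (fun i => w (Sum.inr i)))
/-- Definable functions. -/
def Fn (f : (α → Y) → Y) : Prop := D.DefO (fun x v => x = f v)

theorem app {P : (β → Y) → Prop} (hP : D.Def P) (t : (α → Y) → β → Y)
    (ht : ∀ j, D.Fn (fun v => t v j)) : D.Def (fun v => P (t v)) := by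
  obtain ⟨F, hF⟩ := D.supp' hP
  have h1 : D.Def (fun w : β ⊕ α → Y => (∀ j ∈ F, w (Sum.inl j) = t (fun i => w (Sum.inr i)) j)
      ∧ P (fun j => w (Sum.inl j))) := by
    refine D.and' (D.fin_all F fun j _ => ?_) (D.rel' Sum.inl hP)
    exact D.rel' (fun o : Option α => o.elim (Sum.inl j) Sum.inr) (ht j)
  refine D.congr (D.exs' h1) (fun v => ⟨?_, fun h => ⟨t v, fun j _ => rfl, h⟩⟩)
  rintro ⟨u, hu, h⟩
  exact (hF _ _ hu).1 h

theorem eqd (i j : α) : D.Def (fun v : α → Y => v i = v j) :=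
  D.rel' (fun b : Bool => bif b then j else i) D.eq'

theorem var (i : α) : D.Fn (fun v : α → Y => v i) := D.eqd none (some i)

theorem sub1 {B : Y → Prop} (hB : D.Def1 B) {f : (α → Y) → Y} (hf : D.Fn f) :
    D.Def (fun v => B (f v)) := D.app hB (fun v _ => f v) (fun _ => hf)

theorem sub2 {P : Y → Y → Prop} (hP : D.Def2 P) {f g : (α → Y) → Y} (hf : D.Fn f)
    (hg : D.Fn g) : D.Def (fun v => P (f v) (g v)) :=
  D.app hP (fun v b => bif b then g v else f v) (fun b => by cases b; exacts [hf, hg])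

theorem subO {P : Y → (β → Y) → Prop} (hP : D.DefO P) {f : (α → Y) → Y} (hf : D.Fn f)
    {t : (α → Y) → β → Y} (ht : ∀ j, D.Fn (fun v => t v j)) : D.Def (fun v => P (f v) (t v)) :=
  D.app hP (fun v o => o.elim (f v) (t v)) (fun b => by cases b; exacts [hf, ht _])

theorem subS {P : (γ → Y) → (β → Y) → Prop} (hP : D.DefS P) {s : (α → Y) → γ → Y}
    (hs : ∀ j, D.Fn (fun v => s v j))
    {t : (α → Y) → β → Y} (ht : ∀ j, D.Fn (fun v => t v j)) : D.Def (fun v => P (s v) (t v)) :=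
  D.app hP (fun v o => Sum.elim (s v) (t v) o) (fun b => by cases b; exacts [hs _, ht _])

theorem eqf {f g : (α → Y) → Y} (hf : D.Fn f) (hg : D.Fn g) :
    D.Def (fun v => f v = g v) := D.sub2 (P := fun x y => x = y) D.eq' hf hg

theorem ex {P : Y → (α → Y) → Prop} (hP : D.DefO P) : D.Def (fun v => ∃ x, P x v) := by
  have h := D.exs' (D.rel' (fun o : Option α => o.elim (Sum.inl ()) Sum.inr) hP)
  exact D.congr h (fun v => ⟨fun ⟨u, hu⟩ => ⟨u (), hu⟩, fun ⟨x, hx⟩ => ⟨fun _ => x, hx⟩⟩)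

theorem all {P : Y → (α → Y) → Prop} (hP : D.DefO P) : D.Def (fun v => ∀ x, P x v) :=
  D.congr (D.not' (D.ex (P := fun x v => ¬ P x v) (D.not' hP))) (fun v => by simp)

theorem exS {P : (β → Y) → (α → Y) → Prop} (hP : D.DefS P) : D.Def (fun v => ∃ u, P u v) :=
  D.exs' hP

theorem allS {P : (β → Y) → (α → Y) → Prop} (hP : D.DefS P) : D.Def (fun v => ∀ u, P u v) :=
  D.congr (D.not' (D.exS (P := fun x v => ¬ P x v) (D.not' hP))) (fun v => by simp)

theorem Fn.comp {f : (β → Y) → Y} (hf : D.Fn f) {t : (α → Y) → β → Y}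
    (ht : ∀ j, D.Fn (fun v => t v j)) : D.Fn (fun v => f (t v)) :=
  D.subO (P := fun x v => x = f v) (f := fun w : Option α → Y => w none)
    (t := fun w => t (fun i => w (some i))) hf (D.var none)
    (fun j => D.rel' (fun o : Option α => o.elim none (fun i => some (some i))) (ht j))

theorem not1 {B : Y → Prop} (hB : D.Def1 B) : D.Def1 (fun x => ¬ B x) := D.not' hB

/-- Saturation for a single variable over a tuple. -/
theorem sat1 {β : Type} [Countable β] (S : Set (Y → (β → Y) → Prop)) (hS : ∀ P ∈ S, D.DefO P)
    (b : β → Y) (h : ∀ s : Finset (Y → (β → Y) → Prop), ↑s ⊆ S → ∃ x, ∀ P ∈ s, P x b) :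
    ∃ x, ∀ P ∈ S, P x b := by
  classical
  let c : (Y → (β → Y) → Prop) → ((Unit ⊕ β → Y) → Prop) :=
    fun P w => P (w (Sum.inl ())) (fun i => w (Sum.inr i))
  obtain ⟨u, hu⟩ := D.sat' (c '' S) (by
    rintro _ ⟨P, hP, rfl⟩
    exact D.rel' (fun o : Option β => o.elim (Sum.inl ()) Sum.inr) (hS P hP)) b (by
    intro s hs
    obtain ⟨s', hs', rfl⟩ := Finset.subset_set_image_iff.1 hs
    obtain ⟨x, hx⟩ := h s' hs'
    refine ⟨fun _ => x, fun P hP => ?_⟩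
    obtain ⟨P', hP', rfl⟩ := Finset.mem_image.1 hP
    exact hx P' hP')
  exact ⟨u (), fun P hP => hu _ ⟨P, hP, rfl⟩⟩

/-- Saturation without parameters. -/
theorem sat0 {α : Type} [Countable α] (S : Set ((α → Y) → Prop)) (hS : ∀ P ∈ S, D.Def P)
    (h : ∀ s : Finset ((α → Y) → Prop), ↑s ⊆ S → ∃ x, ∀ P ∈ s, P x) :
    ∃ x, ∀ P ∈ S, P x := by
  classical
  let c : ((α → Y) → Prop) → ((α ⊕ Empty → Y) → Prop) :=
    fun P w => P (fun i => w (Sum.inl i))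
  obtain ⟨u, hu⟩ := D.sat' (c '' S) (by
    rintro _ ⟨P, hP, rfl⟩
    exact D.rel' Sum.inl (hS P hP)) Empty.elim (by
    intro s hs
    obtain ⟨s', hs', rfl⟩ := Finset.subset_set_image_iff.1 hs
    obtain ⟨x, hx⟩ := h s' hs'
    refine ⟨x, fun P hP => ?_⟩
    obtain ⟨P', hP', rfl⟩ := Finset.mem_image.1 hP
    exact hx P' hP')
  exact ⟨u, fun P hP => hu _ ⟨P, hP, rfl⟩⟩

end DefSystem

namespace DefSystem

variable {Y : Type w} (D : DefSystem Y) {α β γ : Type}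

/-- Push-forward of a system along a surjection with definable kernel. -/
def map {X : Type w'} (ρ : Y → X) (hρ : Function.Surjective ρ)
    (hk : D.Def2 (fun x y => ρ x = ρ y)) : DefSystem X where
  Def P := D.Def (fun v => P (fun i => ρ (v i)))
  not' h := D.not' h
  and' h h' := D.and' h h'
  rel' g P h := D.rel' g h
  exs' {α β P} h := by
    refine D.congr (D.exs' h) (fun v => ⟨?_, ?_⟩)
    · rintro ⟨u, hu⟩
      refine ⟨fun i => ρ (u i), ?_⟩
      convert hu using 1
      funext i; cases i <;> rfl
    · rintro ⟨u, hu⟩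
      obtain ⟨s, hs⟩ := hρ.hasRightInverse
      refine ⟨fun i => s (u i), ?_⟩
      convert hu using 1
      funext i; cases i
      · exact hs _
      · rfl
  eq' := hk
  supp' {α P} h := by
    obtain ⟨F, hF⟩ := D.supp' h
    obtain ⟨s, hs⟩ := hρ.hasRightInverse
    refine ⟨F, fun u v huv => ?_⟩
    have := hF (fun i => s (u i)) (fun i => s (v i)) (fun i hi => by rw [huv i hi])
    simpa [hs _] using this
  countable' α _ := by
    have h := D.countable' α
    refine h.preimage_of_injOn (f := fun (P : (α → X) → Prop) (v : α → Y) => P (fun i => ρ (v i))) ?_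
    intro P _ Q _ hPQ
    obtain ⟨s, hs⟩ := hρ.hasRightInverse
    funext u
    have := congrFun hPQ (fun i => s (u i))
    simpa [hs _] using this
  sat' {α β} _ _ S hS b h := by
    classical
    obtain ⟨s, hs⟩ := hρ.hasRightInverse
    let c : ((α ⊕ β → X) → Prop) → ((α ⊕ β → Y) → Prop) := fun P w => P (fun i => ρ (w i))
    have key : ∀ u : α → Y, (fun i => ρ ((Sum.elim u (fun j => s (b j)) : α ⊕ β → Y) i)) =
        Sum.elim (fun i => ρ (u i)) b := by
      intro u; funext i; cases i
      · rfl
      · exact hs _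
    obtain ⟨u, hu⟩ := D.sat' (c '' S) (by rintro _ ⟨P, hP, rfl⟩; exact hS P hP)
      (fun j => s (b j)) (by
        intro s1 hs1
        obtain ⟨s', hs', rfl⟩ := Finset.subset_set_image_iff.1 hs1
        obtain ⟨x, hx⟩ := h s' hs'
        refine ⟨fun i => s (x i), fun P hP => ?_⟩
        obtain ⟨P', hP', rfl⟩ := Finset.mem_image.1 hP
        show P' _
        rw [key]
        simpa [hs _] using hx P' hP')
    refine ⟨fun i => ρ (u i), fun P hP => ?_⟩
    have := hu _ ⟨P, hP, rfl⟩
    rw [← key]; exact this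

/-- Expansion of a system by names for countably many (imaginary) parameters. -/
def name {X : Type w'} (π : Y → X) (hπ : Function.Surjective π) {ι : Type} [Countable ι]
    (b : ι → X) : DefSystem Y where
  Def {α} P := ∃ P' : (α → Y) → (ι → X) → Prop,
    D.DefS (fun v w => P' v (fun i => π (w i))) ∧ ∀ v, P v ↔ P' v b
  not' := by
    rintro α P ⟨P', h, h'⟩
    exact ⟨fun v w => ¬ P' v w, D.not' h, fun v => not_congr (h' v)⟩
  and' := by
    rintro α P Q ⟨P', h, h'⟩ ⟨Q', k, k'⟩
    exact ⟨fun v w => P' v w ∧ Q' v w, D.and' h k, fun v => and_congr (h' v) (k' v)⟩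
  rel' := by
    rintro α β g P ⟨P', h, h'⟩
    exact ⟨fun v w => P' (fun i => v (g i)) w, D.rel' (Sum.map g id) h, fun v => h' _⟩
  exs' := by
    rintro α β P ⟨P', h, h'⟩
    refine ⟨fun v w => ∃ u, P' (Sum.elim u v) w, ?_, fun v => exists_congr fun u => h' _⟩
    refine D.exS (P := fun u (v : β ⊕ ι → Y) => P' (Sum.elim u fun i => v (Sum.inl i))
      (fun i => π (v (Sum.inr i)))) ?_
    refine D.subS (s := fun w : α ⊕ (β ⊕ ι) → Y => Sum.elim (fun i => w (Sum.inl i))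
      (fun i => w (Sum.inr (Sum.inl i)))) (t := fun w i => w (Sum.inr (Sum.inr i))) h ?_ ?_
    · rintro (j | j)
      · exact D.var _
      · exact D.var _
    · intro j; exact D.var _
  eq' := ⟨fun v _ => v false = v true, D.eqd _ _, fun v => Iff.rfl⟩
  supp' := by
    rintro α P ⟨P', h, h'⟩
    obtain ⟨s, hs⟩ := hπ.hasRightInverse
    obtain ⟨F, hF⟩ := D.supp' h
    refine ⟨F.toLeft, fun u v huv => ?_⟩
    have := hF (Sum.elim u (fun i => s (b i))) (Sum.elim v (fun i => s (b i))) (by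
      rintro (i | i) hi
      · exact huv i (Finset.mem_toLeft.2 hi)
      · rfl)
    rw [h', h']
    simpa [hs _] using this
  countable' α _ := by
    obtain ⟨s, hs⟩ := hπ.hasRightInverse
    refine ((D.countable' (α ⊕ ι)).image
      (fun P v => P (Sum.elim v (fun i => s (b i))))).mono ?_
    rintro P ⟨P', h, h'⟩
    refine ⟨_, h, ?_⟩
    funext v
    rw [h' v]
    simp [hs _]
  sat' {α β} _ _ S hS c h := by
    obtain ⟨s, hs⟩ := hπ.hasRightInverse
    let re : (α ⊕ (β ⊕ ι) → Y) → (α ⊕ β → Y) := fun w i => w (i.elim Sum.inl (Sum.inr ∘ Sum.inl))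
    let c' : β ⊕ ι → Y := Sum.elim c (fun i => s (b i))
    have key : ∀ u : α → Y, re (Sum.elim u c') = Sum.elim u c := by
      intro u; funext i; cases i <;> rfl
    choose! P' hP' hP'' using hS
    let T : ((α ⊕ β → Y) → Prop) → ((α ⊕ (β ⊕ ι) → Y) → Prop) :=
      fun P w => P' P (re w) (fun i => π (w (Sum.inr (Sum.inr i))))
    have hT : ∀ P ∈ S, ∀ u, T P (Sum.elim u c') ↔ P (Sum.elim u c) := by
      intro P hP u
      rw [hP'' P hP, ← key]
      simp [T, c', hs _]
    classical
    obtain ⟨u, hu⟩ := D.sat' (T '' S) (by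
        rintro _ ⟨P, hP, rfl⟩
        exact D.rel' (fun i : (α ⊕ β) ⊕ ι => i.elim (fun i => i.elim Sum.inl (Sum.inr ∘ Sum.inl))
          (fun i => Sum.inr (Sum.inr i))) (hP' P hP)) c' (by
        intro s1 hs1
        obtain ⟨s', hs', rfl⟩ := Finset.subset_set_image_iff.1 hs1
        obtain ⟨x, hx⟩ := h s' hs'
        refine ⟨x, fun P hP => ?_⟩
        obtain ⟨P', hP', rfl⟩ := Finset.mem_image.1 hP
        exact (hT _ (hs' hP') _).2 (hx P' hP'))
    exact ⟨u, fun P hP => (hT P hP u).1 (hu _ ⟨P, hP, rfl⟩)⟩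

theorem name_of {X : Type w'} (π : Y → X) (hπ : Function.Surjective π) {ι : Type} [Countable ι]
    (b : ι → X) {P : (α → Y) → Prop} (hP : D.Def P) : (D.name π hπ b).Def P :=
  ⟨fun v _ => P v, D.rel' Sum.inl hP, fun _ => Iff.rfl⟩

/-- Omitting types / Henkin construction. -/
theorem henkin [Nonempty Y] (G : Set Y)
    (hG : ∀ B : Y → Prop, D.Def1 B → (∃ x, B x) →
      ∃ B' : Y → Prop, D.Def1 B' ∧ (∃ x, B' x) ∧ ∀ x, B' x → B x ∧ x ∈ G) :
    ∃ u : ℕ → Y, (∀ k, u k ∈ G) ∧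
      ∀ P : Y → (ℕ → Y) → Prop, D.DefO P → (∃ x, P x u) → ∃ m, P (u m) u := by
  classical
  let C := {P : (ℕ → Y) → Prop // D.Def P ∧ ∃ u, P u}
  have stepG : ∀ (k : ℕ) (c : C), ∃ c' : C, (∀ u, c'.1 u → c.1 u) ∧ ∀ u, c'.1 u → u k ∈ G := by
    rintro k ⟨c, hc, u0, hu0⟩
    obtain ⟨B', hB', ⟨x, hx⟩, h⟩ := hG (fun x => ∃ u, c u ∧ u k = x) (by
      refine D.exS (P := fun u (v : Unit → Y) => c u ∧ u k = v ()) (D.and' ?_ ?_)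
      · exact D.rel' _ hc
      · exact D.eqd _ _) ⟨_, u0, hu0, rfl⟩
    refine ⟨⟨fun u => c u ∧ B' (u k), D.and' hc (D.sub1 hB' (D.var k)), ?_⟩, ?_, ?_⟩
    · obtain ⟨⟨u, hu, rfl⟩, -⟩ := h x hx
      exact ⟨u, hu, hx⟩
    · exact fun u hu => hu.1
    · exact fun u hu => (h _ hu.2).2
  have stepH : ∀ (P : Y → (ℕ → Y) → Prop), D.DefO P → ∀ c : C, ∃ c' : C,
      (∀ u, c'.1 u → c.1 u) ∧ ∃ m, ∀ u, c'.1 u → (∃ x, P x u) → P (u m) u := by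
    rintro P hP ⟨c, hc, u0, hu0⟩
    by_cases hs : ∃ u, c u ∧ ∃ x, P x u
    · obtain ⟨u, hu, x, hx⟩ := hs
      obtain ⟨F, hF⟩ := D.supp' hc
      obtain ⟨F', hF'⟩ := D.supp' hP
      obtain ⟨m, hm⟩ := Infinite.exists_notMem_finset (F ∪ F'.image (fun o => o.getD 0))
      simp only [Finset.mem_union, Finset.mem_image, not_or, not_exists, not_and] at hm
      refine ⟨⟨fun u => c u ∧ P (u m) u, D.and' hc (D.subO hP (D.var m) (fun j => D.var j)), ?_⟩,
        fun u hu => hu.1, m, fun u hu _ => hu.2⟩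
      refine ⟨Function.update u m x, (hF _ _ ?_).1 hu, ?_⟩
      · intro i hi
        rw [Function.update_of_ne]
        rintro rfl; exact hm.1 hi
      · have := hF' (fun o => o.elim x u) (fun o => o.elim x (Function.update u m x)) (by
          rintro (_ | i) hi
          · rfl
          · show u i = _
            simp only [Option.elim]
            rw [Function.update_of_ne]
            rintro rfl; exact hm.2 _ hi rfl)
        simpa using this.1 hx
    · refine ⟨⟨c, hc, u0, hu0⟩, fun u hu => hu, 0, fun u hu h => (hs ⟨u, hu, h⟩).elim⟩
  obtain ⟨f, hf⟩ := (D.countable' (Option ℕ)).exists_eq_range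
    ⟨fun _ => True, D.tt'⟩
  have hfd : ∀ n, D.Def (f n) := fun n => by
    have : f n ∈ {P : (Option ℕ → Y) → Prop | D.Def P} := by rw [hf]; exact ⟨n, rfl⟩
    exact this
  have step : ∀ (n : ℕ) (c : C), ∃ c' : C, (∀ u, c'.1 u → c.1 u) ∧ (∀ u, c'.1 u → u n ∈ G) ∧
      ∃ m, ∀ u, c'.1 u → (∃ x, f n (fun o => o.elim x u)) → f n (fun o => o.elim (u m) u) := by
    intro n c
    obtain ⟨c1, h1, h1'⟩ := stepG n c
    obtain ⟨c2, h2, h2'⟩ := stepH (fun x u => f n (fun o => o.elim x u)) (by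
      refine D.congr (hfd n) (fun v => ?_)
      have : v = fun o => o.elim (v none) (fun i => v (some i)) := by
        funext o; cases o <;> rfl
      exact iff_of_eq (congrArg (f n) this)) c1
    exact ⟨c2, fun u hu => h1 u (h2 u hu), fun u hu => h1' u (h2 u hu), h2'⟩
  choose g g1 g2 g3 using step
  obtain ⟨y0⟩ := ‹Nonempty Y›
  let c : ℕ → C := fun n => Nat.rec ⟨fun _ => True, D.tt', fun _ => y0, trivial⟩ (fun n c => g n c) n
  have hcs : ∀ n, c (n+1) = g n (c n) := fun n => rfl
  have hmono : ∀ m n, m ≤ n → ∀ u, (c n).1 u → (c m).1 u := by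
    intro m n hmn
    induction hmn with
    | refl => exact fun u h => h
    | step _ ih => exact fun u h => ih u (g1 _ _ u h)
  obtain ⟨u, hu⟩ := D.sat0 (Set.range (fun n => (c n).1)) (by
    rintro _ ⟨n, rfl⟩; exact (c n).2.1) (by
    intro s hs
    obtain ⟨s', rfl⟩ : ∃ s' : Finset ℕ, s = s'.image (fun n => (c n).1) := by
      rw [← Set.image_univ] at hs
      obtain ⟨s', -, h⟩ := Finset.subset_set_image_iff.1 hs
      exact ⟨s', h.symm⟩
    obtain ⟨u, hu⟩ := (c (s'.sup id)).2.2
    refine ⟨u, fun P hP => ?_⟩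
    obtain ⟨n, hn, rfl⟩ := Finset.mem_image.1 hP
    exact hmono n _ (Finset.le_sup (f := id) hn) u hu)
  have hu' : ∀ n, (c n).1 u := fun n => hu _ ⟨n, rfl⟩
  refine ⟨u, fun k => g2 k _ u (hu' (k+1)), fun P hP hx => ?_⟩
  have : (fun w : Option ℕ → Y => P (w none) (fun i => w (some i))) ∈ Set.range f := by
    rw [← hf]; exact hP
  obtain ⟨n, hn⟩ := this
  obtain ⟨m, hm⟩ := g3 n (c n)
  refine ⟨m, ?_⟩
  have := hm u (hu' (n+1))
  rw [hn] at this
  exact this hx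

end DefSystem

set_option linter.unusedSectionVars false
set_option linter.unusedVariables false

/-- A definable linear order with initial segment of type omega. -/
structure Frame {X : Type w} [LinearOrder X] (D : DefSystem X) (nat : ℕ → X) : Prop where
  hlt : D.Def2 (fun x y => x < y)
  mono : StrictMono nat
  init : ∀ x n, x ≤ nat n → ∃ m, x = nat m

namespace Frame
variable {X : Type w} [LinearOrder X] {D : DefSystem X} {nat : ℕ → X} (H : Frame D nat)
variable {α β γ : Type}
include H

theorem lt {f g : (α → X) → X} (hf : D.Fn f) (hg : D.Fn g) : D.Def (fun v => f v < g v) :=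
  D.sub2 H.hlt hf hg

theorem le {f g : (α → X) → X} (hf : D.Fn f) (hg : D.Fn g) : D.Def (fun v => f v ≤ g v) :=
  D.congr (D.not' (H.lt hg hf)) (fun v => not_lt)

theorem init_lt {x n} (h : x ≤ nat n) : ∃ m, m ≤ n ∧ x = nat m := by
  obtain ⟨m, rfl⟩ := H.init x n h
  exact ⟨m, H.mono.le_iff_le.1 h, rfl⟩

theorem succ_le {n : ℕ} {z : X} (h : nat n < z) : nat (n+1) ≤ z := by
  by_contra hz
  push Not at hz
  obtain ⟨m, rfl⟩ := H.init z _ hz.le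
  have h1 := H.mono.lt_iff_lt.1 h
  have h2 := H.mono.lt_iff_lt.1 hz
  omega

theorem nat_zero_le (x : X) : nat 0 ≤ x := by
  by_contra hz
  push Not at hz
  obtain ⟨m, rfl⟩ := H.init x _ hz.le
  have h2 := H.mono.lt_iff_lt.1 hz
  omega

theorem const1 (n : ℕ) : D.Def1 (fun x => x = nat n) := by
  induction n with
  | zero =>
    have h : D.Def1 (fun x => ∀ y, x ≤ y) :=
      D.all (P := fun y (v : Unit → X) => v () ≤ y) (H.le (D.var _) (D.var _))
    refine D.congr h fun v => ⟨fun h => ?_, fun h y => ?_⟩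
    · exact le_antisymm (h _) (H.nat_zero_le _)
    · rw [h]; exact H.nat_zero_le _
  | succ n ih =>
    have h : D.Def1 (fun x => ∃ z, z = nat n ∧ z < x ∧ ∀ y, z < y → x ≤ y) := by
      refine D.ex (P := fun z (v : Unit → X) => z = nat n ∧ z < v () ∧ ∀ y, z < y → v () ≤ y) ?_
      refine D.and' (D.sub1 ih (D.var _)) (D.and' (H.lt (D.var _) (D.var _)) ?_)
      refine D.all (P := fun y (v : Option Unit → X) => v none < y → v (some ()) ≤ y) ?_
      exact D.imp (H.lt (D.var _) (D.var _)) (H.le (D.var _) (D.var _))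
    refine D.congr h fun v => ⟨?_, fun h => ?_⟩
    · rintro ⟨z, rfl, h1, h2⟩
      exact le_antisymm (h2 _ (H.mono (Nat.lt_succ_self n))) (H.succ_le h1)
    · exact ⟨_, rfl, by rw [h]; exact H.mono (Nat.lt_succ_self n), fun y hy => by
        rw [h]; exact H.succ_le hy⟩

theorem cst (n : ℕ) : D.Fn (fun _ : α → X => nat n) := D.sub1 (H.const1 n) (D.var _)

end Frame

section core
variable {X : Type w} [LinearOrder X] (D : DefSystem X) (nat : ℕ → X)
variable {α β γ : Type}

/-- `x` lies below every nonstandard initial segment definable from `d`. -/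
def LL (x : X) (d : β → X) : Prop :=
  ∀ P : X → (β → X) → Prop, D.DefO P → (∀ n, P (nat n) d) → P x d

/-- Same without parameters. -/
def LL0 (x : X) : Prop := ∀ B : X → Prop, D.Def1 B → (∀ n, B (nat n)) → B x

/-- Nonstandard elements below everything definable. -/
def QQ (x : X) : Prop := (∀ n, x ≠ nat n) ∧ LL0 D nat x

/-- `x` is separated from the standard elements by a predicate definable over `y`. -/
def RR (x y : X) : Prop := ∃ P : X → X → Prop, D.Def2 P ∧ P x y ∧ ∀ n, ¬ P (nat n) y

/-- Every definable unary predicate is eventually constant. -/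
def Star : Prop := ∀ B : X → Prop, D.Def1 B →
  (∃ N, ∀ n, N ≤ n → B (nat n)) ∨ (∃ N, ∀ n, N ≤ n → ¬ B (nat n))

variable {D nat}

theorem LL.reindex {x : X} {d : β → X} (h : LL D nat x d) (g : γ → β) :
    LL D nat x (fun i => d (g i)) := fun P hP hn =>
  h (fun x v => P x (fun i => v (g i))) (D.subO hP (D.var _) (fun _ => D.var _)) hn

theorem LL.ll0 {x : X} {d : β → X} (h : LL D nat x d) : LL0 D nat x := fun B hB hn =>
  h (fun x _ => B x) (D.sub1 hB (D.var _)) hn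

theorem LL0.ll {x : X} {d : β → X} [IsEmpty β] (h : LL0 D nat x) : LL D nat x d :=
  fun P hP hn => h (fun x => P x d)
    (by
      refine D.subO (f := fun v : Unit → X => v ()) (t := fun _ => d) hP (D.var _) ?_
      exact fun j => isEmptyElim j) hn

variable (H : Frame D nat)
include H

theorem LL.down {x y : X} {d : β → X} (h : LL D nat x d) (hy : y ≤ x) : LL D nat y d := by
  intro P hP hn
  refine h (fun x v => ∀ y, y ≤ x → P y v) ?_ ?_ y hy
  · refine D.all (P := fun y (v : Option β → X) => y ≤ v none → P y (fun i => v (some i))) ?_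
    exact D.imp (H.le (D.var _) (D.var _)) (D.subO hP (D.var _) (fun _ => D.var _))
  · intro n y hy
    obtain ⟨m, rfl⟩ := H.init _ _ hy
    exact hn m

theorem LL0.down {x y : X} (h : LL0 D nat x) (hy : y ≤ x) : LL0 D nat y :=
  ((LL0.ll (d := Empty.elim) h).down H hy).ll0

theorem LL.withNat {x : X} {d : β → X} (h : LL D nat x d) (v : α → ℕ) :
    LL D nat x (Sum.elim (fun i => nat (v i)) d) := by
  intro P hP hn
  refine h (fun x w => P x (Sum.elim (fun i => nat (v i)) w)) ?_ hn
  refine D.subO hP (D.var _) ?_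
  rintro (j | j)
  · exact H.cst _
  · exact D.var _

theorem nonst_gt {x : X} (h : ∀ n, x ≠ nat n) (n : ℕ) : nat n < x := by
  by_contra hx
  push Not at hx
  obtain ⟨m, hm⟩ := H.init _ _ hx
  exact h m hm

theorem LL.ev {x : X} {d : β → X} (h : LL D nat x d) (hx : ∀ n, x ≠ nat n)
    {P : X → (β → X) → Prop} (hP : D.DefO P) (N : ℕ) (hN : ∀ n, N ≤ n → P (nat n) d) : P x d := by
  refine h (fun x v => nat N ≤ x → P x v) ?_ ?_ (nonst_gt H hx N).le
  · exact D.imp (H.le (H.cst _) (D.var _)) hP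
  · exact fun n hn => hN n (H.mono.le_iff_le.1 hn)

theorem QQ.ev {x : X} (h : QQ D nat x) {B : X → Prop} (hB : D.Def1 B) (N : ℕ)
    (hN : ∀ n, N ≤ n → B (nat n)) : B x :=
  (LL0.ll (d := Empty.elim) h.2).ev H h.1 (P := fun x _ => B x) (D.sub1 hB (D.var _)) N hN

theorem QQ.down {x y : X} (h : QQ D nat x) (hy : y ≤ x) (hs : ∀ n, y ≠ nat n) : QQ D nat y :=
  ⟨hs, h.2.down H hy⟩

variable (S : Star D nat)
include S

theorem QQ.same {x y : X} (hx : QQ D nat x) (hy : QQ D nat y) {B : X → Prop} (hB : D.Def1 B) :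
    B x ↔ B y := by
  rcases S B hB with ⟨N, hN⟩ | ⟨N, hN⟩
  · exact iff_of_true (hx.ev H hB N hN) (hy.ev H hB N hN)
  · exact iff_of_false (hx.ev H (D.not1 hB) N hN) (hy.ev H (D.not1 hB) N hN)

theorem LG {G : X → X → Prop} (hG : D.Def2 G) (hm : ∀ a a' m, a ≤ a' → G a m → G a' m) :
    ∃ K, ∀ n, K ≤ n → ∀ n', n ≤ n' → ∀ k, k ≤ n → G (nat k) (nat n') → G (nat k) (nat n) := by
  let B : X → Prop := fun m => ∀ m', (m < m' ∧ ∀ z, m < z → m' ≤ z) → ∀ a, a ≤ m → G a m' → G a m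
  have hB : D.Def1 B := by
    refine D.all (P := fun m' (v : Unit → X) => (v () < m' ∧ ∀ z, v () < z → m' ≤ z) →
      ∀ a, a ≤ v () → G a m' → G a (v ())) ?_
    refine D.imp (D.and' (H.lt (D.var _) (D.var _)) ?_) ?_
    · exact D.all (P := fun z (v : Option Unit → X) => v (some ()) < z → v none ≤ z)
        (D.imp (H.lt (D.var _) (D.var _)) (H.le (D.var _) (D.var _)))
    · exact D.all (P := fun a (v : Option Unit → X) => a ≤ v (some ()) → G a (v none) →
        G a (v (some ())))
        (D.imp (H.le (D.var _) (D.var _)) (D.imp (D.sub2 hG (D.var _) (D.var _))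
          (D.sub2 hG (D.var _) (D.var _))))
  rcases S B hB with ⟨N, hN⟩ | ⟨N, hN⟩
  · refine ⟨N, fun n hn n' hn' => ?_⟩
    induction hn' with
    | refl => exact fun k _ h => h
    | @step m hm' ih =>
      intro k hk h
      refine ih k hk (hN m (le_trans hn hm') (nat (m+1)) ⟨H.mono (Nat.lt_succ_self m),
        fun z hz => H.succ_le hz⟩ _ (H.mono.monotone (le_trans hk hm')) h)
  · exfalso
    have h1 : ∀ n, N ≤ n → ∃ k, G (nat k) (nat (n+1)) ∧ ¬ G (nat k) (nat n) := by
      intro n hn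
      have := hN n hn
      simp only [B, not_forall] at this
      obtain ⟨m', ⟨h1, h2⟩, a, ha, hG1, hG2⟩ := this
      obtain ⟨k, rfl⟩ := H.init _ _ ha
      have : m' = nat (n+1) := le_antisymm (h2 _ (H.mono (Nat.lt_succ_self n))) (H.succ_le h1)
      subst this
      exact ⟨k, hG1, hG2⟩
    have h2 : ∀ k n, N ≤ n → ¬ G (nat k) (nat n) := by
      intro k
      induction k using Nat.strong_induction_on with
      | _ k ih =>
        intro n hn hk
        obtain ⟨k', h3, h4⟩ := h1 n hn
        refine ih k' ?_ (n+1) (by omega) h3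
        by_contra hkk
        exact h4 (hm _ _ _ (H.mono.monotone (by omega : k ≤ k')) hk)
    obtain ⟨k, hk, -⟩ := h1 N le_rfl
    exact h2 k (N+1) (by omega) hk

theorem tameQ [Finite α] {P : X → (α → X) → Prop} (hP : D.DefO P) :
    ∃ ψ : (α → X) → Prop, D.Def ψ ∧ ∀ z, QQ D nat z → ∀ v : α → ℕ,
      (P z (fun i => nat (v i)) ↔ ψ (fun i => nat (v i))) := by
  let G : X → X → Prop := fun a m => ∃ u : α → X, (∀ i, u i ≤ a) ∧
    ∃ m', (m < m' ∧ ∀ z, m < z → m' ≤ z) ∧ ¬ (P m u ↔ P m' u)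
  have hG : D.Def2 G := by
    refine D.exS (P := fun (u : α → X) (v : Bool → X) => (∀ i, u i ≤ v false) ∧
      ∃ m', (v true < m' ∧ ∀ z, v true < z → m' ≤ z) ∧ ¬ (P (v true) u ↔ P m' u)) ?_
    refine D.and' (D.finite_all fun i => H.le (D.var _) (D.var _)) ?_
    refine D.ex (P := fun m' (w : α ⊕ Bool → X) => (w (Sum.inr true) < m' ∧
      ∀ z, w (Sum.inr true) < z → m' ≤ z) ∧ ¬ (P (w (Sum.inr true)) (fun i => w (Sum.inl i)) ↔
        P m' (fun i => w (Sum.inl i)))) ?_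
    refine D.and' (D.and' (H.lt (D.var _) (D.var _)) ?_) (D.not' (D.iff ?_ ?_))
    · exact D.all (P := fun z (v : Option (α ⊕ Bool) → X) => v (some (Sum.inr true)) < z →
        v none ≤ z) (D.imp (H.lt (D.var _) (D.var _)) (H.le (D.var _) (D.var _)))
    · exact D.subO hP (D.var _) (fun _ => D.var _)
    · exact D.subO hP (D.var _) (fun _ => D.var _)
  obtain ⟨K, hK⟩ := LG H S hG (by
    rintro a a' m haa ⟨u, hu, h⟩
    exact ⟨u, fun i => (hu i).trans haa, h⟩)
  have hPc : ∀ v : α → ℕ, D.Def1 (fun z => P z (fun i => nat (v i))) := fun v => by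
    refine D.subO (t := fun _ i => nat (v i)) hP (D.var _) (fun j => H.cst _)
  have hsucc : ∀ n : ℕ, nat n < nat (n+1) ∧ ∀ z, nat n < z → nat (n+1) ≤ z :=
    fun n => ⟨H.mono (Nat.lt_succ_self n), fun z hz => H.succ_le hz⟩
  have hev : ∀ k, ∃ N, ∀ n, N ≤ n → ¬ G (nat k) (nat n) := by
    intro k
    have h1 : ∀ v : α → Fin (k+1), ∃ N, ∀ n, N ≤ n → (P (nat n) (fun i => nat (v i)) ↔
        P (nat (n+1)) (fun i => nat (v i))) := by
      intro v
      rcases S _ (hPc (fun i => v i)) with ⟨N, hN⟩ | ⟨N, hN⟩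
      · exact ⟨N, fun n hn => iff_of_true (hN n hn) (hN _ (by omega))⟩
      · exact ⟨N, fun n hn => iff_of_false (hN n hn) (hN _ (by omega))⟩
    choose N hN using h1
    have := Fintype.ofFinite α
    classical
    refine ⟨Finset.univ.sup N, fun n hn => ?_⟩
    rintro ⟨u, hu, m', ⟨h3, h4⟩, h5⟩
    have hm' : m' = nat (n+1) := le_antisymm (h4 _ (hsucc n).1) (H.succ_le h3)
    subst hm'
    choose v hv using fun i => H.init_lt (hu i)
    obtain rfl : u = fun i => nat (v i) := funext fun i => (hv i).2
    apply h5
    exact hN (fun i => ⟨v i, Nat.lt_succ_of_le (hv i).1⟩) n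
      (le_trans (Finset.le_sup (Finset.mem_univ _)) hn)
  let C : X → (α → X) → Prop := fun m u => nat K ≤ m ∧ ∃ a, a ≤ m ∧ (∀ i, u i ≤ a) ∧ ¬ G a m
  have hC : D.DefO C := by
    refine D.and' (H.le (H.cst _) (D.var _)) ?_
    refine D.ex (P := fun a (w : Option α → X) => a ≤ w none ∧ (∀ i, w (some i) ≤ a) ∧
      ¬ G a (w none)) ?_
    exact D.and' (H.le (D.var _) (D.var _)) (D.and' (D.finite_all fun i => H.le (D.var _) (D.var _))
      (D.not' (D.sub2 hG (D.var _) (D.var _))))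
  let ψ : (α → X) → Prop := fun u => ∃ m, C m u ∧ P m u ∧ ∀ m', m' < m → ¬ C m' u
  have hψ : D.Def ψ := by
    refine D.ex (P := fun m u => C m u ∧ P m u ∧ ∀ m', m' < m → ¬ C m' u) ?_
    refine D.and' hC (D.and' hP ?_)
    refine D.all (P := fun m' (w : Option α → X) => m' < w none → ¬ C m' (fun i => w (some i))) ?_
    exact D.imp (H.lt (D.var _) (D.var _)) (D.not' (D.subO hC (D.var _) (fun _ => D.var _)))
  refine ⟨ψ, hψ, fun z hz v => ?_⟩
  have hCex : ∃ n, C (nat n) (fun i => nat (v i)) := by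
    have := Fintype.ofFinite α
    obtain ⟨N, hN⟩ := hev (Finset.univ.sup v)
    refine ⟨max N (max K (Finset.univ.sup v)), H.mono.monotone (by omega),
      nat (Finset.univ.sup v), H.mono.monotone (by omega), fun i => H.mono.monotone
      (Finset.le_sup (Finset.mem_univ i)), hN _ (by omega)⟩
  have hstab : ∀ n, C (nat n) (fun i => nat (v i)) →
      (P (nat n) (fun i => nat (v i)) ↔ P z (fun i => nat (v i))) := by
    rintro n ⟨h1, a, h2, h3, h4⟩
    have hKn := H.mono.le_iff_le.1 h1
    obtain ⟨k, hk, rfl⟩ := H.init_lt h2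
    have h5 : ∀ n', n ≤ n' → (P (nat n) (fun i => nat (v i)) ↔ P (nat n') (fun i => nat (v i))) := by
      intro n' hn'
      induction hn' with
      | refl => exact Iff.rfl
      | @step m hm ih =>
        refine ih.trans ?_
        by_contra h6
        refine h4 (hK n hKn m hm k hk ⟨_, h3, nat (m+1), hsucc m, h6⟩)
    by_cases hc : P (nat n) (fun i => nat (v i))
    · exact iff_of_true hc (hz.ev H (hPc v) n fun m hm => (h5 m hm).1 hc)
    · exact iff_of_false hc (hz.ev H (D.not1 (hPc v)) n fun m hm h => hc ((h5 m hm).2 h))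
  classical
  have hmin : ∀ m', m' < nat (Nat.find hCex) → ¬ C m' (fun i => nat (v i)) := by
    intro m' hm' hc
    obtain ⟨n, rfl⟩ := H.init _ _ hm'.le
    exact Nat.find_min hCex (H.mono.lt_iff_lt.1 hm') hc
  constructor
  · intro h
    exact ⟨nat (Nat.find hCex), Nat.find_spec hCex, (hstab _ (Nat.find_spec hCex)).2 h, hmin⟩
  · rintro ⟨m, h1, h2, h3⟩
    obtain rfl : m = nat (Nat.find hCex) := by
      rcases lt_trichotomy m (nat (Nat.find hCex)) with h | h | h
      · exact (hmin _ h h1).elim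
      · exact h
      · exact (h3 _ h (Nat.find_spec hCex)).elim
    exact (hstab _ h1).1 h2

theorem RR.trans {x y z : X} (hx : QQ D nat x) (hy : QQ D nat y) (hz : QQ D nat z)
    (hxy : RR D nat x y) (hyz : RR D nat y z) : RR D nat x z := by
  obtain ⟨P1, hP1, h1, h1'⟩ := hxy
  obtain ⟨P2, hP2, h2, h2'⟩ := hyz
  have hc : ∀ n y', QQ D nat y' → ¬ P1 (nat n) y' := fun n y' hy' h => h1' n
    ((hy'.same H S hy (B := fun y => P1 (nat n) y) (D.sub2 hP1 (H.cst n) (D.var _))).1 h)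
  rcases le_or_gt y z with hle | hlt
  · refine ⟨fun x' z' => ∃ y', y' ≤ z' ∧ P2 y' z' ∧ P1 x' y', ?_, ⟨y, hle, h2, h1⟩, ?_⟩
    · refine D.ex (P := fun y' (v : Bool → X) => y' ≤ v true ∧ P2 y' (v true) ∧
        P1 (v false) y') ?_
      exact D.and' (H.le (D.var _) (D.var _)) (D.and' (D.sub2 hP2 (D.var _) (D.var _))
        (D.sub2 hP1 (D.var _) (D.var _)))
    · rintro n ⟨y', hy', h3, h4⟩
      refine hc n y' (hz.down H hy' ?_) h4
      rintro m rfl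
      exact h2' m h3
  · rcases le_or_gt z x with hzx | hxz
    · refine ⟨fun x y => y ≤ x, H.le (D.var _) (D.var _), hzx, fun n => ?_⟩
      exact not_le.2 (nonst_gt H hz.1 n)
    let F : X → X → Prop := fun a m => ∃ x', x' ≤ a ∧ P1 x' m
    have hF : D.Def2 F := D.ex (P := fun x' (v : Bool → X) => x' ≤ v false ∧ P1 x' (v true))
      (D.and' (H.le (D.var _) (D.var _)) (D.sub2 hP1 (D.var _) (D.var _)))
    obtain ⟨K, hK⟩ := LG H S hF (by
      rintro a a' m haa ⟨x', hx', h⟩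
      exact ⟨x', hx'.trans haa, h⟩)
    have key := hy.2 (fun m => ∀ m1 m2 a, nat K ≤ m1 ∧ m1 ≤ m2 ∧ m2 ≤ m ∧ a ≤ m1 → F a m2 → F a m1)
      (by
        refine D.all (P := fun m1 (v : Unit → X) => ∀ m2 a, nat K ≤ m1 ∧ m1 ≤ m2 ∧ m2 ≤ v () ∧
          a ≤ m1 → F a m2 → F a m1) ?_
        refine D.all (P := fun m2 (v : Option Unit → X) => ∀ a, nat K ≤ v none ∧ v none ≤ m2 ∧
          m2 ≤ v (some ()) ∧ a ≤ v none → F a m2 → F a (v none)) ?_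
        refine D.all (P := fun a (v : Option (Option Unit) → X) => nat K ≤ v (some none) ∧
          v (some none) ≤ v none ∧ v none ≤ v (some (some ())) ∧ a ≤ v (some none) →
          F a (v none) → F a (v (some none))) ?_
        refine D.imp (D.and' (H.le (H.cst _) (D.var _)) (D.and' (H.le (D.var _) (D.var _))
          (D.and' (H.le (D.var _) (D.var _)) (H.le (D.var _) (D.var _))))) (D.imp
          (D.sub2 hF (D.var _) (D.var _)) (D.sub2 hF (D.var _) (D.var _))))
      (by
        rintro n m1 m2 a ⟨g1, g2, g3, g4⟩ g5
        obtain ⟨n2, hn2, rfl⟩ := H.init_lt g3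
        obtain ⟨n1, hn1, rfl⟩ := H.init_lt g2
        obtain ⟨k, hk, rfl⟩ := H.init_lt g4
        exact hK n1 (H.mono.le_iff_le.1 g1) n2 hn1 k hk g5)
    refine ⟨F, hF, key z y x ⟨(nonst_gt H hz.1 K).le, hlt.le, le_rfl, hxz.le⟩ ⟨x, le_rfl, h1⟩, ?_⟩
    rintro n ⟨x', hx', h⟩
    obtain ⟨m, rfl⟩ := H.init _ _ hx'
    exact hc m z hz h

end core

set_option linter.unusedSectionVars false
set_option linter.unusedVariables false

section good
variable {X : Type w} [LinearOrder X] {D : DefSystem X} {nat : ℕ → X}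
variable {α β γ : Type}
variable {ι : Type} [LinearOrder ι] [Countable ι]

variable (D nat) in
/-- Each member of the sequence lies infinitely far below the later ones. -/
def GoodSeq (F : Finset ι) (u : ι → X) : Prop :=
  ∀ i ∈ F, QQ D nat (u i) ∧ LL D nat (u i) (fun j : {j // j ∈ F ∧ i < j} => u j)

variable (D nat) in
/-- `x` is infinitely far below the members of the sequence with index in `F`. -/
def LLF (b : ι → X) (x : X) (F : Finset ι) : Prop :=
  LL D nat x (fun j : {j // j ∈ F} => b j)

variable (H : Frame D nat) (S : Star D nat)
include H

theorem LL_exists [Countable β] (d : β → X) : ∃ y, (∀ n, y ≠ nat n) ∧ LL D nat y d := by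
  classical
  obtain ⟨y, hy⟩ := D.sat1 {P : X → (β → X) → Prop | D.DefO P ∧ ∃ N, ∀ n, N ≤ n → P (nat n) d}
    (fun P hP => hP.1) d (by
      intro s hs
      choose! N hN using fun P (hP : P ∈ s) => (hs hP).2
      exact ⟨nat (s.sup N), fun P hP => hN P hP _ (Finset.le_sup hP)⟩)
  refine ⟨y, fun n => ?_, fun P hP h => hy P ⟨hP, 0, fun n _ => h n⟩⟩
  refine hy (fun x _ => x ≠ nat n) ⟨D.not' (D.sub1 (H.const1 n) (D.var _)), n+1, fun m hm h => ?_⟩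
  have := H.mono.injective h
  omega

theorem good_exists (F : Finset ι) : ∃ u : ι → X, GoodSeq D nat F u := by
  classical
  induction F using Finset.induction_on_min with
  | empty => exact ⟨fun _ => nat 0, fun i hi => by simp at hi⟩
  | insert a s ha ih =>
    obtain ⟨u, hu⟩ := ih
    obtain ⟨y, hy1, hy2⟩ := LL_exists H (fun j : {j // j ∈ s} => u j)
    have hne : ∀ j, a < j → Function.update u a y j = u j := fun j hj =>
      Function.update_of_ne hj.ne' _ _
    refine ⟨Function.update u a y, fun i hi => ?_⟩
    rcases Finset.mem_insert.1 hi with rfl | hi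
    · rw [Function.update_self]
      refine ⟨⟨hy1, hy2.ll0⟩, ?_⟩
      have := hy2.reindex (fun j : {j // j ∈ insert i s ∧ i < j} =>
        (⟨j.1, (Finset.mem_insert.1 j.2.1).resolve_left j.2.2.ne'⟩ : {j // j ∈ s}))
      convert this using 2 with j
      exact hne _ j.2.2
    · rw [hne _ (ha i hi)]
      refine ⟨(hu i hi).1, ?_⟩
      have := (hu i hi).2.reindex (fun j : {j // j ∈ insert a s ∧ i < j} =>
        (⟨j.1, (Finset.mem_insert.1 j.2.1).resolve_left ((ha i hi).trans j.2.2).ne', j.2.2⟩ :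
          {j // j ∈ s ∧ i < j}))
      convert this using 2 with j
      exact hne _ ((ha i hi).trans j.2.2)

omit H in
theorem GoodSeq.mono {F F' : Finset ι} {u : ι → X} (h : GoodSeq D nat F' u) (hF : F ⊆ F') :
    GoodSeq D nat F u := fun i hi => ⟨(h i (hF hi)).1,
  (h i (hF hi)).2.reindex (fun j : {j // j ∈ F ∧ i < j} =>
    (⟨j.1, hF j.2.1, j.2.2⟩ : {j // j ∈ F' ∧ i < j}))⟩

include S

theorem utame (F : Finset ι) : ∀ (α : Type) [Finite α] (P : (α → X) → ({j // j ∈ F} → X) → Prop),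
    D.DefS P → ∃ ψ : (α → X) → Prop, D.Def ψ ∧ ∀ u : ι → X, GoodSeq D nat F u → ∀ v : α → ℕ,
      (P (fun i => nat (v i)) (fun j => u j) ↔ ψ (fun i => nat (v i))) := by
  classical
  induction F using Finset.induction_on_min with
  | empty =>
    intro α _ P hP
    refine ⟨fun w => ∃ u, P w u, ?_, fun u _ v => ⟨fun h => ⟨_, h⟩, ?_⟩⟩
    · refine D.exS (P := fun u w => P w u) (D.subS hP (fun _ => D.var _) (fun _ => D.var _))
    · rintro ⟨u', hu'⟩
      convert hu' using 1
      funext ⟨j, hj⟩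
      simp at hj
  | insert a s ha ih =>
    intro α _ P hP
    have mem : ∀ j, j ∈ insert a s → j ≠ a → j ∈ s := fun j hj h =>
      (Finset.mem_insert.1 hj).resolve_left h
    let P' : (Option α → X) → ({j // j ∈ s} → X) → Prop := fun w d =>
      P (fun i => w (some i)) (fun j => if h : j.1 = a then w none else d ⟨j.1, mem _ j.2 h⟩)
    have hP' : D.DefS P' := by
      refine D.subS hP (fun _ => D.var _) ?_
      intro j
      by_cases h : j.1 = a
      · simp only [h, dif_pos]; exact D.var _
      · simp only [h, dif_neg, not_false_eq_true]; exact D.var _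
    obtain ⟨ψ1, hψ1, h1⟩ := ih (Option α) P' hP'
    obtain ⟨ψ, hψ, h2⟩ := tameQ H S (α := α) (P := fun x w => ψ1 (fun o => o.elim x w)) (by
      refine D.app hψ1 _ ?_
      rintro (_ | j)
      · exact D.var _
      · exact D.var _)
    refine ⟨ψ, hψ, fun u hu v => ?_⟩
    have hua := hu a (Finset.mem_insert_self _ _)
    rw [← h2 (u a) hua.1 v]
    have hLL := (hua.2.reindex (fun j : {j // j ∈ s} => (⟨j.1, Finset.mem_insert_of_mem j.2,
      ha _ j.2⟩ : {j // j ∈ insert a s ∧ a < j}))).withNat H v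
    have := hLL (fun x d => (P' (fun o => o.elim x (fun i => d (Sum.inl i)))
        (fun j => d (Sum.inr j)) ↔
      ψ1 (fun o => o.elim x (fun i => d (Sum.inl i))))) (by
        refine D.iff (D.subS (P := P') hP' (s := fun (w : Option (α ⊕ {j // j ∈ s}) → X) o =>
            o.elim (w none) (fun i => w (some (Sum.inl i))))
            (t := fun w j => w (some (Sum.inr j))) ?_ (fun _ => D.var _))
          (D.app hψ1 (fun (w : Option (α ⊕ {j // j ∈ s}) → X) o =>
            o.elim (w none) (fun i => w (some (Sum.inl i)))) ?_)
        · rintro (_ | j)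
          · exact D.var _
          · exact D.var _
        · rintro (_ | j)
          · exact D.var _
          · exact D.var _) (by
      intro n
      have := h1 u (hu.mono (Finset.subset_insert _ _)) (fun o => o.elim n v)
      have e : (fun o : Option α => nat (o.elim n v)) = fun o => o.elim (nat n) (fun i => nat (v i)) := by
        funext o; cases o <;> rfl
      rw [e] at this
      exact this)
    refine Iff.trans ?_ this
    refine iff_of_eq ?_
    show P _ _ = P _ _
    congr 1
    funext j
    by_cases h : j.1 = a
    · simp [h]
    · simp [h]

variable (ι) in
theorem exists_good : ∃ b : ι → X, ∀ F : Finset ι, GoodSeq D nat F b := by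
  classical
  obtain ⟨b, hb⟩ := D.sat0 {P : (ι → X) → Prop | D.Def P ∧ ∃ F, ∀ u, GoodSeq D nat F u → P u}
    (fun P hP => hP.1) (by
      intro s hs
      choose! F hF using fun P (hP : P ∈ s) => (hs hP).2
      obtain ⟨u, hu⟩ := good_exists H (s.sup F)
      exact ⟨u, fun P hP => hF P hP u (hu.mono (Finset.le_sup (f := F) hP))⟩)
  refine ⟨b, fun F i hi => ?_⟩
  have hLL : LL D nat (b i) (fun j : {j // j ∈ F ∧ i < j} => b j) := by
    intro P hP hn
    let F' := F.filter (i < ·)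
    let g : {j // j ∈ F ∧ i < j} → {j // j ∈ F'} := fun j => ⟨j.1, Finset.mem_filter.2 j.2⟩
    obtain ⟨ψ, hψ, h⟩ := utame H S F' Unit (fun w d => P (w ()) (fun j => d (g j)))
      (D.subO hP (D.var _) (fun _ => D.var _))
    have h1 : ∀ n, ψ (fun _ => nat n) := by
      intro n
      refine (hb (fun u => P (nat n) (fun j => u j) ↔ ψ (fun _ => nat n)) ⟨?_, F', ?_⟩).1 (hn n)
      · exact D.iff (D.subO hP (H.cst n) (fun _ => D.var _)) (D.app hψ _ (fun _ => H.cst n))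
      · intro u hu
        exact h u hu (fun _ => n)
    refine hb (fun u => P (u i) (fun j => u j)) ⟨D.subO hP (D.var _) (fun _ => D.var _), F, ?_⟩
    intro u hu
    refine (hu i hi).2 P hP fun n => ?_
    exact (h u (hu.mono (Finset.filter_subset _ _)) (fun _ => n)).2 (h1 n)
  refine ⟨⟨fun n => ?_, hLL.ll0⟩, hLL⟩
  refine hb (fun u => u i ≠ nat n) ⟨D.not' (D.sub1 (H.const1 n) (D.var _)), {i}, fun u hu => ?_⟩
  exact (hu i (by simp)).1.1 n

omit S in
theorem good_lt {b : ι → X} (hb : ∀ F : Finset ι, GoodSeq D nat F b) {i j : ι} (hij : i < j) :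
    b i < b j := by
  classical
  have := (hb {i, j} i (by simp)).2.reindex
    (fun _ : Unit => (⟨j, by simp, hij⟩ : {k // k ∈ ({i, j} : Finset ι) ∧ i < k}))
  exact this (fun x d => x < d ()) (H.lt (D.var _) (D.var _))
    (fun n => nonst_gt H (hb {j} j (by simp)).1.1 n)

omit S in
theorem good_RR {b : ι → X} (hb : ∀ F : Finset ι, GoodSeq D nat F b) {i j : ι} (hij : i ≤ j) :
    RR D nat (b j) (b i) := by
  refine ⟨fun x y => y ≤ x, H.le (D.var _) (D.var _), ?_, fun n => not_le.2 ?_⟩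
  · rcases hij.lt_or_eq with h | rfl
    · exact (good_lt H hb h).le
    · exact le_rfl
  · exact nonst_gt H (hb {i} i (by simp)).1.1 n

omit S in
theorem good_not_RR {b : ι → X} (hb : ∀ F : Finset ι, GoodSeq D nat F b) {i j : ι} (hij : i < j) :
    ¬ RR D nat (b i) (b j) := by
  classical
  rintro ⟨P, hP, h1, h2⟩
  have := (hb {i, j} i (by simp)).2.reindex
    (fun _ : Unit => (⟨j, by simp, hij⟩ : {k // k ∈ ({i, j} : Finset ι) ∧ i < k}))
  exact this (fun x d => ¬ P x (d ())) (D.not' (D.sub2 hP (D.var _) (D.var _))) h2 h1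

/-! Lemma C -/

theorem agree [Finite α] {b : ι → X} (hb : ∀ F : Finset ι, GoodSeq D nat F b) (F : Finset ι)
    {P : (α → X) → ({j // j ∈ F} → X) → Prop} (hP : D.DefS P) :
    ∃ ψ : (α → X) → Prop, D.Def ψ ∧ ∀ y, LLF D nat b y F → ∀ u : α → X, (∀ i, u i ≤ y) →
      (P u (fun j => b j) ↔ ψ u) := by
  obtain ⟨ψ, hψ, h⟩ := utame H S F α P hP
  refine ⟨ψ, hψ, fun y hy => ?_⟩
  refine hy (fun y d => ∀ u : α → X, (∀ i, u i ≤ y) → (P u d ↔ ψ u)) ?_ ?_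
  · refine D.allS (P := fun u (w : Option {j // j ∈ F} → X) => (∀ i, u i ≤ w none) →
      (P u (fun i => w (some i)) ↔ ψ u)) ?_
    exact D.imp (D.finite_all fun i => H.le (D.var _) (D.var _))
      (D.iff (D.subS hP (fun _ => D.var _) (fun _ => D.var _)) (D.app hψ _ (fun _ => D.var _)))
  · intro n u hu
    choose v hv using fun i => H.init _ _ (hu i)
    obtain rfl : u = fun i => nat (v i) := funext hv
    exact h b (hb F) v

omit H S in
theorem pick {b : ι → X} {x : X} (h0 : LL0 D nat x) (F : Finset ι) (h : ¬ LLF D nat b x F) :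
    ∃ i ∈ F, LLF D nat b x (F.filter (i < ·)) ∧ ¬ LLF D nat b x (F.filter (i ≤ ·)) := by
  classical
  induction F using Finset.induction_on_min with
  | empty =>
    exfalso
    refine h ?_
    have : IsEmpty {j : ι // j ∈ (∅ : Finset ι)} := ⟨fun j => absurd j.2 (Finset.notMem_empty _)⟩
    exact h0.ll
  | insert a s ha ih =>
    by_cases hs : LLF D nat b x s
    · refine ⟨a, by simp, ?_, ?_⟩
      · have : (insert a s).filter (a < ·) = s := by
          ext j; simp only [Finset.mem_filter, Finset.mem_insert]
          constructor
          · rintro ⟨rfl | h, h'⟩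
            · exact (lt_irrefl _ h').elim
            · exact h
          · exact fun h => ⟨Or.inr h, ha _ h⟩
        rw [this]; exact hs
      · have : (insert a s).filter (a ≤ ·) = insert a s := by
          ext j; simp only [Finset.mem_filter, Finset.mem_insert]
          constructor
          · exact fun h => h.1
          · rintro (rfl | h)
            · exact ⟨Or.inl rfl, le_rfl⟩
            · exact ⟨Or.inr h, (ha _ h).le⟩
        rw [this]; exact h
    · obtain ⟨i, hi, h1, h2⟩ := ih hs
      refine ⟨i, by simp [hi], ?_, ?_⟩
      · have : (insert a s).filter (i < ·) = s.filter (i < ·) := by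
          rw [Finset.filter_insert, if_neg (ha i hi).not_gt]
        rw [this]; exact h1
      · have : (insert a s).filter (i ≤ ·) = s.filter (i ≤ ·) := by
          rw [Finset.filter_insert, if_neg (ha i hi).not_ge]
        rw [this]; exact h2

theorem lemA {b : ι → X} (hb : ∀ F : Finset ι, GoodSeq D nat F b) (F : Finset ι)
    {θ : X → ({j // j ∈ F} → X) → Prop} (hθ : D.DefO θ) (i : ι) (hi : i ∈ F) :
    ∃ ψ : X → ({j // j ∈ F ∧ j ≤ i} → X) → Prop, D.DefO ψ ∧
      ∀ y, b i ≤ y → LLF D nat b y (F.filter (i < ·)) → ∀ x, x ≤ y →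
        (θ x (fun j => b j) ↔ ψ x (fun j => b j)) := by
  classical
  let P : (Option {j // j ∈ F ∧ j ≤ i} → X) → ({j // j ∈ F.filter (i < ·)} → X) → Prop :=
    fun w d => θ (w none) (fun j => if h : j.1 ≤ i then w (some ⟨j.1, j.2, h⟩) else
      d ⟨j.1, Finset.mem_filter.2 ⟨j.2, not_le.1 h⟩⟩)
  have hP : D.DefS P := by
    refine D.subO hθ (D.var _) ?_
    intro j
    by_cases h : j.1 ≤ i
    · simp only [h, dif_pos]; exact D.var _
    · simp only [h, dif_neg, not_false_eq_true]; exact D.var _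
  have : Finite {j // j ∈ F ∧ j ≤ i} :=
    Finite.of_injective (fun j : {j // j ∈ F ∧ j ≤ i} => (⟨j.1, j.2.1⟩ : {j // j ∈ F}))
      (fun j k h => Subtype.ext (congrArg (fun z : {j // j ∈ F} => z.1) h))
  obtain ⟨ψ, hψ, h⟩ := agree H S hb (F.filter (i < ·)) hP
  refine ⟨fun x e => ψ (fun o => o.elim x e), D.app hψ _ (by
    rintro (_ | j)
    · exact D.var _
    · exact D.var _), fun y hy hLL x hx => ?_⟩
  have hk := h y hLL (fun o => o.elim x (fun j => b j)) (by
    rintro (_ | ⟨j, hj⟩)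
    · exact hx
    · refine le_trans ?_ hy
      rcases hj.2.lt_or_eq with h' | h'
      · exact (good_lt H hb h').le
      · exact (congrArg b h').le)
  refine Iff.trans (iff_of_eq ?_) hk
  show θ x _ = θ x _
  congr 1
  funext j
  by_cases h : j.1 ≤ i
  · simp [h]
  · simp [h]

theorem lemC {b : ι → X} (hb : ∀ F : Finset ι, GoodSeq D nat F b)
    {θ : X → (ι → X) → Prop} (hθ : D.DefO θ) (hne : ∃ x, θ x b) :
    ∃ θ' : X → (ι → X) → Prop, D.DefO θ' ∧ (∃ x, θ' x b) ∧ ∀ x, θ' x b → θ x b ∧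
      (QQ D nat x → ∃ i, RR D nat x (b i) ∧ RR D nat (b i) x) := by
  classical
  by_cases hA : ∀ x, θ x b → QQ D nat x
  swap
  · push Not at hA
    obtain ⟨x, hx, hxQ⟩ := hA
    by_cases hst : ∃ n, x = nat n
    · obtain ⟨n, rfl⟩ := hst
      refine ⟨fun x _ => x = nat n, D.sub1 (H.const1 n) (D.var _), ⟨_, rfl⟩, ?_⟩
      rintro _ rfl
      exact ⟨hx, fun h => (hxQ h).elim⟩
    · push Not at hst
      have : ¬ LL0 D nat x := fun h => hxQ ⟨hst, h⟩
      unfold LL0 at this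
      push Not at this
      obtain ⟨B, hB, hn, hBx⟩ := this
      refine ⟨fun x d => θ x d ∧ ¬ B x, D.and' hθ (D.not' (D.sub1 hB (D.var _))), ⟨x, hx, hBx⟩, ?_⟩
      exact fun y hy => ⟨hy.1, fun h => (hy.2 (h.2 B hB hn)).elim⟩
  -- restrict to finitely many parameters
  obtain ⟨F, θF, hθF, hF⟩ : ∃ (F : Finset ι) (θF : X → ({j // j ∈ F} → X) → Prop), D.DefO θF ∧
      ∀ x, θ x b ↔ θF x (fun j => b j) := by
    obtain ⟨F0, hF0⟩ := D.supp' hθ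
    let F : Finset ι := F0.eraseNone
    refine ⟨F, fun x d => ∃ u : ι → X, (∀ j : {j // j ∈ F}, u j = d j) ∧ θ x u, ?_, fun x =>
      ⟨fun h => ⟨b, fun _ => rfl, h⟩, ?_⟩⟩
    · refine D.exS (P := fun (u : ι → X) (w : Option {j // j ∈ F} → X) =>
        (∀ j : {j // j ∈ F}, u j = w (some j)) ∧ θ (w none) u) ?_
      exact D.and' (D.finite_all fun j => D.eqd _ _) (D.subO hθ (D.var _) (fun _ => D.var _))
    · rintro ⟨u, hu, h⟩
      refine (hF0 (fun o => o.elim x u) (fun o => o.elim x b) ?_).1 h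
      rintro (_ | j) hj
      · rfl
      · exact hu ⟨j, Finset.mem_eraseNone.2 hj⟩
  have hpick : ∀ x, θ x b → ∃ i ∈ F, LLF D nat b x (F.filter (i < ·)) ∧
      ¬ LLF D nat b x (F.filter (i ≤ ·)) := by
    intro x hx
    refine pick (hA x hx).2 F fun h => ?_
    refine h (fun x d => ¬ θF x d) (D.not' hθF) (fun n hn => ?_) ((hF x).1 hx)
    exact (hA _ ((hF _).2 hn)).1 n rfl
  have hbi : ∀ i ∈ F, LLF D nat b (b i) (F.filter (i < ·)) := fun i hi =>
    (hb F i hi).2.reindex (fun j : {j // j ∈ F.filter (i < ·)} =>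
      (⟨j.1, Finset.mem_filter.1 j.2⟩ : {j // j ∈ F ∧ i < j}))
  have hmax : ∀ x i, i ∈ F → LLF D nat b x (F.filter (i < ·)) →
      LLF D nat b (max x (b i)) (F.filter (i < ·)) := by
    intro x i hi hx
    rcases max_choice x (b i) with h | h <;> rw [h]
    · exact hx
    · exact hbi i hi
  have hfin : ∀ i, Finite {j // j ∈ F ∧ j ≤ i} := fun i =>
    Finite.of_injective (fun j : {j // j ∈ F ∧ j ≤ i} => (⟨j.1, j.2.1⟩ : {j // j ∈ F}))
      (fun j k h => Subtype.ext (congrArg (fun z : {j // j ∈ F} => z.1) h))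
  have hble : ∀ i (j : {j // j ∈ F ∧ j ≤ i}), b j ≤ b i := by
    intro i j
    rcases j.2.2.lt_or_eq with h' | h'
    · exact (good_lt H hb h').le
    · exact (congrArg b h').le
  -- existence of a minimum
  obtain ⟨x0, hx0, hmin⟩ : ∃ x0, θ x0 b ∧ ∀ x, x < x0 → ¬ θ x b := by
    obtain ⟨x, hx⟩ := hne
    obtain ⟨i, hi, h1, h2⟩ := hpick x hx
    obtain ⟨ψ, hψ, hag⟩ := lemA H S hb F hθF i hi
    have hy := hmax x i hi h1
    have hag' := hag _ (le_max_right _ _) hy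
    have hfi := hfin i
    obtain ⟨x0, h3, h4, h5⟩ := hy.ll0 (fun y => ∀ e : {j // j ∈ F ∧ j ≤ i} → X, (∀ j, e j ≤ y) →
      (∃ x, x ≤ y ∧ ψ x e) → ∃ x, x ≤ y ∧ ψ x e ∧ ∀ x', x' < x → ¬ ψ x' e) (by
        refine D.allS (P := fun (e : {j // j ∈ F ∧ j ≤ i} → X) (v : Unit → X) =>
          (∀ j, e j ≤ v ()) →
          (∃ x, x ≤ v () ∧ ψ x e) → ∃ x, x ≤ v () ∧ ψ x e ∧ ∀ x', x' < x → ¬ ψ x' e) ?_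
        refine D.imp (D.finite_all fun j => H.le (D.var _) (D.var _)) (D.imp ?_ ?_)
        · refine D.ex (P := fun x (w : {j // j ∈ F ∧ j ≤ i} ⊕ Unit → X) => x ≤ w (Sum.inr ()) ∧
            ψ x (fun i => w (Sum.inl i))) ?_
          exact D.and' (H.le (D.var _) (D.var _)) (D.subO hψ (D.var _) (fun _ => D.var _))
        · refine D.ex (P := fun x (w : {j // j ∈ F ∧ j ≤ i} ⊕ Unit → X) => x ≤ w (Sum.inr ()) ∧
            ψ x (fun i => w (Sum.inl i)) ∧ ∀ x', x' < x → ¬ ψ x' (fun i => w (Sum.inl i))) ?_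
          refine D.and' (H.le (D.var _) (D.var _)) (D.and' (D.subO hψ (D.var _) (fun _ => D.var _)) ?_)
          refine D.all (P := fun x' (w : Option ({j // j ∈ F ∧ j ≤ i} ⊕ Unit) → X) =>
            x' < w none → ¬ ψ x' (fun i => w (some (Sum.inl i)))) ?_
          exact D.imp (H.lt (D.var _) (D.var _)) (D.not' (D.subO hψ (D.var _) (fun _ => D.var _))))
      (by
        rintro n e - ⟨x, hx, hψx⟩
        have hex : ∃ m, ψ (nat m) e := by
          obtain ⟨m, rfl⟩ := H.init _ _ hx
          exact ⟨m, hψx⟩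
        obtain ⟨m, rfl⟩ := H.init _ _ hx
        refine ⟨nat (Nat.find hex), (H.mono.monotone (Nat.find_min' hex hψx)).trans hx,
          Nat.find_spec hex, fun x' hx' h => ?_⟩
        obtain ⟨k, rfl⟩ := H.init _ _ hx'.le
        exact Nat.find_min hex (H.mono.lt_iff_lt.1 hx') h)
      (fun j => b j) (fun j => (hble i j).trans (le_max_right _ _))
      ⟨x, le_max_left _ _, (hag' x (le_max_left _ _)).1 ((hF x).1 hx)⟩
    refine ⟨x0, (hF _).2 ((hag' x0 h3).2 h4), fun x' hx' h => h5 x' hx' ?_⟩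
    exact (hag' x' (hx'.le.trans h3)).1 ((hF _).1 h)
  refine ⟨fun x d => θ x d ∧ ∀ x', x' < x → ¬ θ x' d, ?_, ⟨x0, hx0, hmin⟩, ?_⟩
  · refine D.and' hθ ?_
    refine D.all (P := fun x' (w : Option ι → X) => x' < w none → ¬ θ x' (fun i => w (some i))) ?_
    exact D.imp (H.lt (D.var _) (D.var _)) (D.not' (D.subO hθ (D.var _) (fun _ => D.var _)))
  rintro x ⟨hx, hxmin⟩
  obtain rfl : x = x0 := by
    rcases lt_trichotomy x x0 with h | h | h
    · exact (hmin _ h hx).elim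
    · exact h
    · exact (hxmin _ h hx0).elim
  refine ⟨hx, fun hQ => ?_⟩
  obtain ⟨i, hi, h1, h2⟩ := hpick x hx
  have hy := hmax x i hi h1
  refine ⟨i, ?_, ?_⟩
  · unfold LLF LL at h2
    push Not at h2
    obtain ⟨P, hP, hPn, hPx⟩ := h2
    let P' : (Bool → X) → ({j // j ∈ F.filter (i < ·)} → X) → Prop := fun w d =>
      P (w false) (fun j => if h : j.1 = i then w true else d ⟨j.1, Finset.mem_filter.2
        ⟨(Finset.mem_filter.1 j.2).1, lt_of_le_of_ne (Finset.mem_filter.1 j.2).2 (Ne.symm h)⟩⟩)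
    have hP' : D.DefS P' := by
      refine D.subO hP (D.var _) ?_
      intro j
      by_cases h : j.1 = i
      · simp only [h, dif_pos]; exact D.var _
      · simp only [h, dif_neg, not_false_eq_true]; exact D.var _
    have hPP : ∀ x, P' (fun c => bif c then b i else x) (fun j => b j) ↔ P x (fun j => b j) := by
      intro x
      refine iff_of_eq ?_
      show P x _ = P x _
      congr 1
      funext j
      by_cases h : j.1 = i
      · simp [h]
      · simp [h]
    obtain ⟨ψ, hψ, hag⟩ := agree H S hb _ hP'
    have hag' : ∀ x', x' ≤ max x (b i) →
        (P x' (fun j => b j) ↔ ψ (fun c => bif c then b i else x')) := by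
      intro x' hx'
      refine (hPP x').symm.trans (hag _ hy (fun c => bif c then b i else x') ?_)
      rintro (_ | _)
      · exact hx'
      · exact le_max_right _ _
    refine ⟨fun x y => ¬ ψ (fun c => bif c then y else x), D.not' (D.app hψ _ ?_), ?_, fun n => ?_⟩
    · rintro (_ | _)
      · exact D.var _
      · exact D.var _
    · exact fun h => hPx ((hag' x (le_max_left _ _)).2 h)
    · exact fun h => h ((hag' _ ((nonst_gt H hQ.1 n).le.trans (le_max_left _ _))).1 (hPn n))
  · obtain ⟨ψ, hψ, hag⟩ := lemA H S hb F hθF i hi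
    have hag' := hag _ (le_max_right _ _) hy
    have hfi := hfin i
    have hdm : D.DefO (fun x (e : {j // j ∈ F ∧ j ≤ i} → X) => ψ x e ∧ ∀ x', x' < x → ¬ ψ x' e) := by
      refine D.and' hψ ?_
      refine D.all (P := fun x' (w : Option {j // j ∈ F ∧ j ≤ i} → X) => x' < w none →
        ¬ ψ x' (fun i => w (some i))) ?_
      exact D.imp (H.lt (D.var _) (D.var _)) (D.not' (D.subO hψ (D.var _) (fun _ => D.var _)))
    refine ⟨fun m x => ∃ e : {j // j ∈ F ∧ j ≤ i} → X, (∀ j, e j ≤ m) ∧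
      (ψ x e ∧ ∀ x', x' < x → ¬ ψ x' e), ?_, ⟨fun j => b j, hble i, ?_, ?_⟩, ?_⟩
    · refine D.exS (P := fun (e : {j // j ∈ F ∧ j ≤ i} → X) (v : Bool → X) =>
        (∀ j, e j ≤ v false) ∧ (ψ (v true) e ∧ ∀ x', x' < v true → ¬ ψ x' e)) ?_
      refine D.and' (D.finite_all fun j => H.le (D.var _) (D.var _)) ?_
      exact D.subO (P := fun x (e : {j // j ∈ F ∧ j ≤ i} → X) => ψ x e ∧ ∀ x', x' < x → ¬ ψ x' e)
        (f := fun w : {j // j ∈ F ∧ j ≤ i} ⊕ Bool → X => w (Sum.inr true))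
        (t := fun w j => w (Sum.inl j)) hdm (D.var _) (fun _ => D.var _)
    · exact (hag' x (le_max_left _ _)).1 ((hF x).1 hx)
    · intro x' hx' h
      exact hmin x' hx' ((hF x').2 ((hag' x' (hx'.le.trans (le_max_left _ _))).2 h))
    · rintro n ⟨e, he, h3, h4⟩
      choose v hv using fun j => H.init _ _ (he j)
      obtain rfl : e = fun j => nat (v j) := funext hv
      have hB : D.Def1 (fun x => ψ x (fun j => nat (v j)) ∧
          ∀ x', x' < x → ¬ ψ x' (fun j => nat (v j))) :=
        D.subO (P := fun x (e : {j // j ∈ F ∧ j ≤ i} → X) => ψ x e ∧ ∀ x', x' < x → ¬ ψ x' e)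
          (t := fun _ j => nat (v j)) hdm (D.var _) (fun _ => H.cst _)
      refine hQ.2 _ (D.not1 hB) (fun k hk => ?_) ⟨h3, h4⟩
      exact h4 (nat k) (nonst_gt H hQ.1 k) hk.1

end good

set_option linter.unusedSectionVars false
set_option linter.unusedVariables false

/-- The range of `u` satisfies the Tarski-Vaught condition. -/
def ElemD {Y : Type w} (D : DefSystem Y) (u : ℕ → Y) : Prop :=
  ∀ P : Y → (ℕ → Y) → Prop, D.DefO P → (∃ x, P x u) → ∃ m, P (u m) u

section models
variable {Y : Type w} (D : DefSystem Y) {X : Type w'} [LinearOrder X] (π : Y → X)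
  (hπ : Function.Surjective π) (hk : D.Def2 (fun x y => π x = π y)) (nat : ℕ → X)

/-- A countable model coding the order `ι`. -/
structure Mdl (ι : Type) [LinearOrder ι] (u : ℕ → Y) (b : ι → X) : Prop where
  elem : ElemD D u
  good : ∀ F : Finset ι, GoodSeq (D.map π hπ hk) nat F b
  emb : ∀ k, QQ (D.map π hπ hk) nat (π (u k)) →
    ∃ i, RR (D.map π hπ hk) nat (π (u k)) (b i) ∧ RR (D.map π hπ hk) nat (b i) (π (u k))
  rep : ∀ i, ∃ k, π (u k) = b i

variable {D π hπ hk nat}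
variable (H : Frame (D.map π hπ hk) nat) (S : Star (D.map π hπ hk) nat)
include H S

theorem exists_mdl (ι : Type) [LinearOrder ι] [Countable ι] :
    ∃ u b, Mdl D π hπ hk nat ι u b := by
  obtain ⟨b, hb⟩ := exists_good ι H S
  have hne : Nonempty Y := ⟨(hπ (nat 0)).choose⟩
  obtain ⟨u, hu1, hu2⟩ := (D.name π hπ b).henkin {x | QQ (D.map π hπ hk) nat (π x) →
    ∃ i, RR (D.map π hπ hk) nat (π x) (b i) ∧ RR (D.map π hπ hk) nat (b i) (π x)} (by
    rintro B hB ⟨x, hx⟩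
    obtain ⟨P', hP', hBP⟩ := id hB
    have hθ : (D.map π hπ hk).DefO (fun x d => ∃ m, π m = x ∧ P' (fun _ => m) d) := by
      show D.Def _
      refine D.ex (P := fun m (w : Option ι → Y) => π m = π (w none) ∧
        P' (fun _ => m) (fun i => π (w (some i)))) ?_
      exact D.and' (D.sub2 hk (D.var _) (D.var _))
        (D.rel' (Sum.elim (fun _ => none) (fun i => some (some i))) hP')
    obtain ⟨θ', h1, ⟨x', hx'⟩, h3⟩ := lemC H S hb hθ ⟨π x, x, rfl, (hBP _).1 hx⟩
    refine ⟨fun m => B m ∧ θ' (π m) b, DefSystem.and' _ hB ⟨fun v d => θ' (π (v ())) d, ?_,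
      fun _ => Iff.rfl⟩, ?_, ?_⟩
    · exact D.rel' (fun o : Option ι => o.elim (Sum.inl ()) Sum.inr) h1
    · obtain ⟨⟨m, rfl, hm⟩, -⟩ := h3 x' hx'
      exact ⟨m, (hBP (fun _ => m)).2 hm, hx'⟩
    · rintro m ⟨hm, hm'⟩
      exact ⟨hm, (h3 _ hm').2⟩)
  refine ⟨u, b, ?_, hb, hu1, fun i => ?_⟩
  · intro P hP hx
    exact hu2 P (D.name_of π hπ b hP) hx
  · refine hu2 (fun x _ => π x = b i) ⟨fun v d => π (v none) = d i, ?_, fun _ => Iff.rfl⟩ (hπ _)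
    exact D.sub2 hk (D.var _) (D.var _)

omit H S in
theorem QQ_transfer {x x' : Y} (h : ∀ B : Y → Prop, D.Def1 B → (B x ↔ B x'))
    (H : Frame (D.map π hπ hk) nat)
    (hx : QQ (D.map π hπ hk) nat (π x)) : QQ (D.map π hπ hk) nat (π x') := by
  refine ⟨fun n hn => hx.1 n ?_, fun B hB hn => ?_⟩
  · exact (h (fun x => π x = nat n) (H.const1 n)).2 hn
  · exact (h (fun x => B (π x)) hB).1 (hx.2 B hB hn)

omit H S in
theorem RR_transfer {x x' y y' : Y} (h : ∀ P : Y → Y → Prop, D.Def2 P → (P x y ↔ P x' y'))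
    (H : Frame (D.map π hπ hk) nat)
    (hx : RR (D.map π hπ hk) nat (π x) (π y)) : RR (D.map π hπ hk) nat (π x') (π y') := by
  obtain ⟨P, hP, h1, h2⟩ := hx
  refine ⟨P, hP, (h (fun x y => P (π x) (π y)) hP).1 h1, fun n hn => h2 n ?_⟩
  refine (h (fun x y => P (nat n) (π y)) ?_).2 hn
  exact (D.map π hπ hk).sub2 hP (H.cst n) ((D.map π hπ hk).var (α := Bool) true)

theorem orderIso_of {ι ι' : Type} [LinearOrder ι] [LinearOrder ι'] [Countable ι] [Countable ι']
    {u u' : ℕ → Y} {b : ι → X} {b' : ι' → X} (h : Mdl D π hπ hk nat ι u b)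
    (h' : Mdl D π hπ hk nat ι' u' b') (e : Set.range u ≃ Set.range u')
    (he : ∀ P : Y → Y → Prop, D.Def2 P → ∀ x y : Set.range u, P x y ↔ P (e x) (e y)) :
    Nonempty (ι ≃o ι') := by
  have he1 : ∀ x : Set.range u, ∀ B : Y → Prop, D.Def1 B → (B x ↔ B (e x)) := fun x B hB =>
    he (fun x _ => B x) (D.sub1 hB (D.var _)) x x
  have hR : ∀ x y : Set.range u, RR (D.map π hπ hk) nat (π x) (π y) ↔
      RR (D.map π hπ hk) nat (π (e x)) (π (e y)) := fun x y =>
    ⟨RR_transfer (fun P hP => he P hP x y) H, RR_transfer (fun P hP => (he P hP x y).symm) H⟩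
  have hQ : ∀ x : Set.range u, QQ (D.map π hπ hk) nat (π x) ↔
      QQ (D.map π hπ hk) nat (π (e x)) := fun x =>
    ⟨QQ_transfer (he1 x) H, QQ_transfer (fun B hB => (he1 x B hB).symm) H⟩
  have hbQ : ∀ i, QQ (D.map π hπ hk) nat (b i) := fun i => (h.good {i} i (by simp)).1
  have hbQ' : ∀ i, QQ (D.map π hπ hk) nat (b' i) := fun i => (h'.good {i} i (by simp)).1
  have hrep : ∀ i, ∃ x : Set.range u, π x = b i := fun i => by
    obtain ⟨k, hk⟩ := h.rep i
    exact ⟨⟨u k, k, rfl⟩, hk⟩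
  choose x hx using hrep
  have hrep' : ∀ i, ∃ x : Set.range u', π x = b' i := fun i => by
    obtain ⟨k, hk⟩ := h'.rep i
    exact ⟨⟨u' k, k, rfl⟩, hk⟩
  have hxQ : ∀ i, QQ (D.map π hπ hk) nat (π (e (x i))) := fun i =>
    (hQ (x i)).1 (by rw [hx]; exact hbQ i)
  have hemb : ∀ y : Set.range u, QQ (D.map π hπ hk) nat (π y) →
    ∃ i, RR (D.map π hπ hk) nat (π y) (b i) ∧ RR (D.map π hπ hk) nat (b i) (π y) := by
    rintro ⟨_, k, rfl⟩
    exact h.emb k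
  have hemb' : ∀ y : Set.range u', QQ (D.map π hπ hk) nat (π y) →
    ∃ i, RR (D.map π hπ hk) nat (π y) (b' i) ∧ RR (D.map π hπ hk) nat (b' i) (π y) := by
    rintro ⟨_, k, rfl⟩
    exact h'.emb k
  choose σ hσ1 hσ2 using fun i => hemb' (e (x i)) (hxQ i)
  have key : ∀ i i', RR (D.map π hπ hk) nat (b i) (b i') ↔
      RR (D.map π hπ hk) nat (b' (σ i)) (b' (σ i')) := by
    intro i i'
    rw [← hx i, ← hx i', hR]
    constructor
    · intro hr
      exact RR.trans H S (hbQ' _) (hxQ i') (hbQ' _)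
        (RR.trans H S (hbQ' _) (hxQ i) (hxQ i') (hσ2 i) hr) (hσ1 i')
    · intro hr
      exact RR.trans H S (hxQ i) (hbQ' _) (hxQ i')
        (RR.trans H S (hxQ i) (hbQ' _) (hbQ' _) (hσ1 i) hr) (hσ2 i')
  have hmono : StrictMono σ := by
    intro i i' hii
    by_contra hc
    push Not at hc
    exact good_not_RR H h.good hii ((key i i').2 (good_RR H h'.good hc))
  have hsurj : Function.Surjective σ := by
    intro j
    obtain ⟨y, hy⟩ := hrep' j
    have hyQ : QQ (D.map π hπ hk) nat (π (e.symm y)) := (hQ _).2 (by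
      rw [e.apply_symm_apply, hy]; exact hbQ' j)
    obtain ⟨i, h1, h2⟩ := hemb _ hyQ
    rw [← hx i, hR, e.apply_symm_apply, hy] at h1
    rw [← hx i, hR, e.apply_symm_apply, hy] at h2
    refine ⟨i, ?_⟩
    rcases lt_trichotomy (σ i) j with hl | hl | hl
    · exact (good_not_RR H h'.good hl
        (RR.trans H S (hbQ' _) (hxQ i) (hbQ' _) (hσ2 i) h2)).elim
    · exact hl
    · exact (good_not_RR H h'.good hl
        (RR.trans H S (hbQ' _) (hxQ i) (hbQ' _) h1 (hσ1 i))).elim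
  exact ⟨hmono.orderIsoOfSurjective σ hsurj⟩

end models

section dich
variable {X : Type w} [LinearOrder X] {D : DefSystem X} {nat : ℕ → X}

theorem tree_types
    (hsp : ∀ B : X → Prop, D.Def1 B → (∀ N, ∃ n, N ≤ n ∧ B (nat n)) → ∃ C : X → Prop, D.Def1 C ∧
      (∀ N, ∃ n, N ≤ n ∧ B (nat n) ∧ C (nat n)) ∧ (∀ N, ∃ n, N ≤ n ∧ B (nat n) ∧ ¬ C (nat n))) :
    ∃ F : (ℕ → Bool) → X, ∀ f g, (∀ B, D.Def1 B → (B (F f) ↔ B (F g))) → f = g := by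
  classical
  let U := {B : X → Prop // D.Def1 B ∧ ∀ N, ∃ n, N ≤ n ∧ B (nat n)}
  choose! c hc1 hc2 hc3 using hsp
  let child : U → Bool → U := fun B b => if h : b = true then
    ⟨fun x => B.1 x ∧ c B.1 x, D.and' B.2.1 (hc1 _ B.2.1 B.2.2), hc2 _ B.2.1 B.2.2⟩ else
    ⟨fun x => B.1 x ∧ ¬ c B.1 x, D.and' B.2.1 (D.not' (hc1 _ B.2.1 B.2.2)), hc3 _ B.2.1 B.2.2⟩
  have child_le : ∀ B b x, (child B b).1 x → B.1 x := by
    rintro B (_ | _) x h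
    · exact h.1
    · exact h.1
  let node : (ℕ → Bool) → ℕ → U := fun f n =>
    Nat.rec ⟨fun _ => True, D.tt', fun N => ⟨N, le_rfl, trivial⟩⟩ (fun n B => child B (f n)) n
  have node_succ : ∀ f n, node f (n+1) = child (node f n) (f n) := fun f n => rfl
  have node_anti : ∀ f m n, m ≤ n → ∀ x, (node f n).1 x → (node f m).1 x := by
    intro f m n hmn
    induction n, hmn using Nat.le_induction with
    | base => exact fun x h => h
    | succ n hmn ih => exact fun x h => ih x (child_le _ _ _ h)
  have hF : ∀ f, ∃ x, ∀ n, (node f n).1 x := by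
    intro f
    obtain ⟨v, hv⟩ := D.sat0 (α := Unit) (Set.range (fun n (v : Unit → X) => (node f n).1 (v ()))) (by
      rintro _ ⟨n, rfl⟩
      exact (node f n).2.1) (by
      intro s hs
      choose! k hk using fun P (hP : P ∈ s) => hs hP
      obtain ⟨n, -, hn⟩ := (node f (s.sup k)).2.2 0
      refine ⟨fun _ => nat n, fun P hP => ?_⟩
      rw [← hk P hP]
      exact node_anti f _ _ (Finset.le_sup (f := k) hP) _ hn)
    exact ⟨v (), fun n => hv _ ⟨n, rfl⟩⟩
  choose F hF using hF
  refine ⟨F, fun f g hfg => ?_⟩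
  have agree : ∀ n, (∀ m, m < n → f m = g m) → node f n = node g n := by
    intro n
    induction n with
    | zero => intro _; rfl
    | succ n ih =>
      intro h
      rw [node_succ, node_succ, ih (fun m hm => h m (by omega)), h n (by omega)]
  funext n
  induction n using Nat.strong_induction_on with
  | _ n ih =>
    have hn := agree n ih
    have h1 := hF f (n+1)
    have h2 := hF g (n+1)
    rw [node_succ] at h1 h2
    rw [hn] at h1
    have hd := hfg _ (hc1 _ (node g n).2.1 (node g n).2.2)
    cases hf : f n <;> cases hg : g n
    · rfl
    · rw [hf] at h1; rw [hg] at h2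
      exact (h1.2 (hd.2 h2.2)).elim
    · rw [hf] at h1; rw [hg] at h2
      exact (h2.2 (hd.1 h1.2)).elim
    · rfl

theorem star_frame (H : Frame D nat) (χ : X → Prop) (hχ : D.Def1 χ)
    (hu : ∀ N, ∃ n, N ≤ n ∧ χ (nat n))
    (hst : ∀ C : X → Prop, D.Def1 C → (∃ N, ∀ n, N ≤ n → χ (nat n) → C (nat n)) ∨
      (∃ N, ∀ n, N ≤ n → χ (nat n) → ¬ C (nat n))) :
    ∃ (r : X → {x // χ x}) (hr : Function.Surjective r) (hk : D.Def2 (fun x y => r x = r y))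
      (nat' : ℕ → {x // χ x}), Frame (D.map r hr hk) nat' ∧ Star (D.map r hr hk) nat' := by
  classical
  let q : ℕ → Prop := fun n => χ (nat n)
  have hinf : (setOf q).Infinite := by
    refine Set.infinite_of_not_bddAbove ?_
    rintro ⟨N, hN⟩
    obtain ⟨n, hn, hq⟩ := hu (N+1)
    have := hN (show n ∈ setOf q from hq)
    omega
  let nat' : ℕ → {x // χ x} := fun k => ⟨nat (Nat.nth q k), Nat.nth_mem_of_infinite hinf k⟩
  let r : X → {x // χ x} := fun x => if h : χ x then ⟨x, h⟩ else nat' 0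
  have r_of : ∀ x : {x // χ x}, r x.1 = x := fun x => by simp [r, x.2]
  have hr : Function.Surjective r := fun x => ⟨x.1, r_of x⟩
  have hg : ∀ {α : Type} (i : α), D.Fn (fun v : α → X => (r (v i)).1) := by
    intro α i
    have h : D.Def (fun w : Option α → X => (χ (w (some i)) ∧ w none = w (some i)) ∨
      (¬ χ (w (some i)) ∧ w none = nat (Nat.nth q 0))) :=
      D.or (D.and' (D.sub1 hχ (D.var _)) (D.eqd _ _))
        (D.and' (D.not' (D.sub1 hχ (D.var _))) (D.sub1 (H.const1 _) (D.var _)))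
    refine D.congr h fun w => ?_
    by_cases hw : χ (w (some i))
    · simp [r, hw]
    · simp [r, hw, nat']
  have hk : D.Def2 (fun x y => r x = r y) :=
    D.congr (D.eqf (hg (α := Bool) false) (hg true)) fun v => Subtype.ext_iff.symm
  refine ⟨r, hr, hk, nat', ⟨?_, ?_, ?_⟩, ?_⟩
  · exact D.congr (H.lt (hg (α := Bool) false) (hg true)) fun v => Iff.rfl
  · exact fun i j hij => H.mono (Nat.nth_strictMono hinf hij)
  · intro x n hx
    obtain ⟨m, hm⟩ := H.init x.1 _ hx
    refine ⟨Nat.count q m, Subtype.ext ?_⟩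
    have hq : q m := by show χ (nat m); rw [← hm]; exact x.2
    show x.1 = nat (Nat.nth q (Nat.count q m))
    rw [Nat.nth_count hq, hm]
  · intro B hB
    have hle : ∀ n, n ≤ Nat.nth q n := fun n => (Nat.nth_strictMono hinf).le_apply
    have e : ∀ n, r (nat (Nat.nth q n)) = nat' n := fun n => r_of (nat' n)
    rcases hst (fun x => B (r x)) hB with ⟨N, hN⟩ | ⟨N, hN⟩
    · refine Or.inl ⟨N, fun n hn => ?_⟩
      rw [← e]
      exact hN _ (hn.trans (hle n)) (Nat.nth_mem_of_infinite hinf n)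
    · refine Or.inr ⟨N, fun n hn => ?_⟩
      rw [← e]
      exact hN _ (hn.trans (hle n)) (Nat.nth_mem_of_infinite hinf n)

theorem dichotomy (H : Frame D nat) :
    (∃ F : (ℕ → Bool) → X, ∀ f g, (∀ B, D.Def1 B → (B (F f) ↔ B (F g))) → f = g) ∨
    ∃ (χ : X → Prop) (r : X → {x // χ x}) (hr : Function.Surjective r)
      (hk : D.Def2 (fun x y => r x = r y))
      (nat' : ℕ → {x // χ x}), Frame (D.map r hr hk) nat' ∧ Star (D.map r hr hk) nat' := by
  by_cases hsp : ∀ B : X → Prop, D.Def1 B → (∀ N, ∃ n, N ≤ n ∧ B (nat n)) →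
      ∃ C : X → Prop, D.Def1 C ∧
      (∀ N, ∃ n, N ≤ n ∧ B (nat n) ∧ C (nat n)) ∧ (∀ N, ∃ n, N ≤ n ∧ B (nat n) ∧ ¬ C (nat n))
  · exact Or.inl (tree_types hsp)
  · right
    push Not at hsp
    obtain ⟨χ, hχ, hu, h⟩ := hsp
    refine ⟨χ, star_frame H χ hχ hu fun C hC => ?_⟩
    by_cases hc : ∀ N, ∃ n, N ≤ n ∧ χ (nat n) ∧ C (nat n)
    · left
      obtain ⟨N, hN⟩ := h C hC hc
      exact ⟨N, hN⟩
    · right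
      push Not at hc
      exact hc

end dich

section orders

/-- Shuffle of finite orders. -/
abbrev Shuf (c : ℚ → ℕ) : Type := {x : ℚ ×ₗ ℕ // (ofLex x).2 ≤ c (ofLex x).1}

theorem Shuf.lt_iff {c : ℚ → ℕ} {x y : Shuf c} : x < y ↔ (ofLex x.1).1 < (ofLex y.1).1 ∨
    ((ofLex x.1).1 = (ofLex y.1).1 ∧ (ofLex x.1).2 < (ofLex y.1).2) := by
  rw [← Subtype.coe_lt_coe, Prod.Lex.lt_iff]

theorem Shuf.covBy_iff {c : ℚ → ℕ} {x y : Shuf c} : x ⋖ y ↔ (ofLex x.1).1 = (ofLex y.1).1 ∧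
    (ofLex y.1).2 = (ofLex x.1).2 + 1 := by
  constructor
  · rintro ⟨h1, h2⟩
    rw [Shuf.lt_iff] at h1
    rcases h1 with h | ⟨h, h'⟩
    · obtain ⟨q, hq1, hq2⟩ := exists_between h
      exact (h2 (c := ⟨toLex (q, 0), Nat.zero_le _⟩) (Shuf.lt_iff.2 (Or.inl hq1))
        (Shuf.lt_iff.2 (Or.inl hq2))).elim
    · refine ⟨h, ?_⟩
      by_contra hne
      have hy := y.2
      rw [← h] at hy
      refine h2 (c := ⟨toLex ((ofLex x.1).1, (ofLex x.1).2 + 1), ?_⟩)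
        (Shuf.lt_iff.2 (Or.inr ⟨rfl, ?_⟩)) (Shuf.lt_iff.2 (Or.inr ⟨h, ?_⟩))
      · show (ofLex x.1).2 + 1 ≤ c (ofLex x.1).1
        omega
      · exact Nat.lt_succ_self _
      · show (ofLex x.1).2 + 1 < (ofLex y.1).2
        omega
  · rintro ⟨h1, h2⟩
    refine ⟨Shuf.lt_iff.2 (Or.inr ⟨h1, by omega⟩), fun z hz1 hz2 => ?_⟩
    rw [Shuf.lt_iff] at hz1 hz2
    rcases hz1 with h | ⟨h, h'⟩ <;> rcases hz2 with k | ⟨k, k'⟩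
    · exact absurd (h.trans k) (by rw [h1]; exact lt_irrefl _)
    · rw [k, ← h1] at h; exact lt_irrefl _ h
    · rw [← h, h1] at k; exact lt_irrefl _ k
    · omega

/-- There is a maximal finite discrete block with `n+1` elements. -/
def Blk (ι : Type) [LinearOrder ι] (n : ℕ) : Prop :=
  ∃ e : ℕ → ι, (∀ k, k < n → e k ⋖ e (k+1)) ∧ (∀ x, ¬ x ⋖ e 0) ∧ ∀ x, ¬ e n ⋖ x

theorem Blk.iso {ι ι' : Type} [LinearOrder ι] [LinearOrder ι'] (h : ι ≃o ι') {n : ℕ}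
    (hn : Blk ι n) : Blk ι' n := by
  obtain ⟨e, h1, h2, h3⟩ := hn
  refine ⟨fun k => h (e k), fun k hk => (apply_covBy_apply_iff h).2 (h1 k hk), fun x hx => ?_,
    fun x hx => ?_⟩
  · rw [← h.apply_symm_apply x, apply_covBy_apply_iff] at hx
    exact h2 _ hx
  · rw [← h.apply_symm_apply x, apply_covBy_apply_iff] at hx
    exact h3 _ hx

theorem Shuf.blk_iff (c : ℚ → ℕ) (n : ℕ) : Blk (Shuf c) n ↔ n ∈ Set.range c := by
  constructor
  · rintro ⟨e, h1, h2, h3⟩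
    have key : ∀ k, k ≤ n → (ofLex (e k).1).1 = (ofLex (e 0).1).1 ∧ (ofLex (e k).1).2 = k := by
      intro k
      induction k with
      | zero =>
        intro _
        refine ⟨rfl, ?_⟩
        by_contra hne
        have := (e 0).2
        refine h2 ⟨toLex ((ofLex (e 0).1).1, (ofLex (e 0).1).2 - 1), ?_⟩ (Shuf.covBy_iff.2 ⟨rfl, ?_⟩)
        · show (ofLex (e 0).1).2 - 1 ≤ c (ofLex (e 0).1).1
          omega
        · show (ofLex (e 0).1).2 = (ofLex (e 0).1).2 - 1 + 1
          omega
      | succ k ih =>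
        intro hk
        obtain ⟨i1, i2⟩ := ih (by omega)
        obtain ⟨j1, j2⟩ := Shuf.covBy_iff.1 (h1 k (by omega))
        exact ⟨j1.symm.trans i1, by omega⟩
    obtain ⟨k1, k2⟩ := key n le_rfl
    refine ⟨(ofLex (e n).1).1, ?_⟩
    by_contra hne
    have := (e n).2
    refine h3 ⟨toLex ((ofLex (e n).1).1, (ofLex (e n).1).2 + 1), ?_⟩ (Shuf.covBy_iff.2 ⟨rfl, rfl⟩)
    show (ofLex (e n).1).2 + 1 ≤ c (ofLex (e n).1).1
    omega
  · rintro ⟨q, rfl⟩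
    refine ⟨fun k => ⟨toLex (q, min k (c q)), Nat.min_le_right _ _⟩, fun k hk =>
      Shuf.covBy_iff.2 ⟨rfl, ?_⟩, fun x hx => ?_, fun x hx => ?_⟩
    · show min (k+1) (c q) = min k (c q) + 1
      omega
    · have : min 0 (c q) = (ofLex x.1).2 + 1 := (Shuf.covBy_iff.1 hx).2
      omega
    · have h1 : q = (ofLex x.1).1 := (Shuf.covBy_iff.1 hx).1
      have h2 : (ofLex x.1).2 = min (c q) (c q) + 1 := (Shuf.covBy_iff.1 hx).2
      have := x.2
      rw [← h1] at this
      omega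

theorem exists_shuf (f : ℕ → Bool) : ∃ c : ℚ → ℕ, Set.range c = {n | n = 0 ∨ f (n - 1) = true} := by
  obtain ⟨g, hg⟩ := (Set.to_countable {n : ℕ | n = 0 ∨ f (n - 1) = true}).exists_eq_range ⟨0, Or.inl rfl⟩
  refine ⟨fun q => g (Denumerable.eqv ℚ q), ?_⟩
  rw [hg]
  exact (Denumerable.eqv ℚ).surjective.range_comp g

/-- The multiplicity function coding `f`. -/
noncomputable def shufc (f : ℕ → Bool) : ℚ → ℕ := (exists_shuf f).choose

theorem shuf_inj {f g : ℕ → Bool} (h : Nonempty (Shuf (shufc f) ≃o Shuf (shufc g))) : f = g := by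
  obtain ⟨h⟩ := h
  funext n
  have h1 : ∀ f : ℕ → Bool, Blk (Shuf (shufc f)) (n+1) ↔ f n = true := fun f => by
    rw [Shuf.blk_iff, shufc, (exists_shuf f).choose_spec]
    simp
  have := (h1 f).symm.trans ((⟨Blk.iso h, Blk.iso h.symm⟩ : _ ↔ _).trans (h1 g))
  exact Bool.eq_iff_iff.2 this

instance (c : ℚ → ℕ) : Countable (Shuf c) := by
  have : Countable (ℚ ×ₗ ℕ) := inferInstanceAs (Countable (ℚ × ℕ))
  infer_instance

end orders

section ldef
variable (L : FirstOrder.Language.{u, v}) {M : Type w} [L.Structure M]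

/-- Predicates definable without parameters in a structure. -/
def LDef {α : Type} (P : (α → M) → Prop) : Prop := ∃ φ : L.Formula α, ∀ v, P v ↔ φ.Realize v

variable {L}

theorem LDef.congr' {α : Type} {P Q : (α → M) → Prop} (h : LDef L P) (hPQ : ∀ v, P v ↔ Q v) :
    LDef L Q := by
  obtain ⟨φ, hφ⟩ := h
  exact ⟨φ, fun v => (hPQ v).symm.trans (hφ v)⟩

theorem LDef.neg {α : Type} {P : (α → M) → Prop} (h : LDef L P) : LDef L (fun v => ¬ P v) := by
  obtain ⟨φ, hφ⟩ := h
  exact ⟨φ.not, fun v => by rw [Formula.realize_not]; exact not_congr (hφ v)⟩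

theorem LDef.and {α : Type} {P Q : (α → M) → Prop} (h : LDef L P) (h' : LDef L Q) :
    LDef L (fun v => P v ∧ Q v) := by
  obtain ⟨φ, hφ⟩ := h
  obtain ⟨ψ, hψ⟩ := h'
  exact ⟨φ ⊓ ψ, fun v => by rw [Formula.realize_inf]; exact and_congr (hφ v) (hψ v)⟩

theorem LDef.rel {α β : Type} (g : α → β) {P : (α → M) → Prop} (h : LDef L P) :
    LDef L (fun v : β → M => P (fun i => v (g i))) := by
  obtain ⟨φ, hφ⟩ := h
  exact ⟨φ.relabel g, fun v => by rw [Formula.realize_relabel]; exact hφ _⟩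

theorem LDef.tt {α : Type} : LDef L (fun _ : α → M => True) :=
  ⟨⊤, fun v => by simp [Formula.Realize]⟩

theorem LDef.eq {α : Type} (i j : α) : LDef L (fun v : α → M => v i = v j) :=
  ⟨Term.equal (Term.var i) (Term.var j), fun v => by simp [Formula.realize_equal]⟩

theorem LDef.fin_all {α : Type} {ι : Type*} (F : Finset ι) {P : ι → (α → M) → Prop}
    (h : ∀ i ∈ F, LDef L (P i)) : LDef L (fun v => ∀ i ∈ F, P i v) := by
  classical
  induction F using Finset.induction_on with
  | empty => exact LDef.tt.congr' (fun v => by simp)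
  | insert a s ha ih =>
    refine ((h a (by simp)).and (ih fun i hi => h i (by simp [hi]))).congr' (fun v => ?_)
    simp

theorem LDef.supp {α : Type} {P : (α → M) → Prop} (h : LDef L P) :
    ∃ F : Finset α, ∀ u v : α → M, (∀ i ∈ F, u i = v i) → (P u ↔ P v) := by
  classical
  obtain ⟨φ, hφ⟩ := h
  refine ⟨φ.freeVarFinset, fun u v huv => ?_⟩
  rw [hφ, hφ]
  unfold Formula.Realize
  rw [← BoundedFormula.realize_restrictFreeVar (f := id) (v := fun i => u i) u (fun _ => rfl),
    ← BoundedFormula.realize_restrictFreeVar (f := id) (v := fun i => v i) v (fun _ => rfl)]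
  have : (fun i : φ.freeVarFinset => u i) = fun i : φ.freeVarFinset => v i :=
    funext fun i => huv i i.2
  rw [this]

theorem LDef.exs [Nonempty M] {α β : Type} {P : (α ⊕ β → M) → Prop} (h : LDef L P) :
    LDef L (fun v : β → M => ∃ u : α → M, P (Sum.elim u v)) := by
  classical
  obtain ⟨φ, hφ⟩ := h
  let F : Finset α := φ.freeVarFinset.toLeft
  let f : φ.freeVarFinset → β ⊕ F := fun i => match i with
    | ⟨Sum.inl a, h⟩ => Sum.inr ⟨a, Finset.mem_toLeft.2 h⟩
    | ⟨Sum.inr b, _⟩ => Sum.inl b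
  let φ' : L.Formula (β ⊕ F) := φ.restrictFreeVar f
  have key : ∀ (u : α → M) (v : β → M), φ'.Realize (Sum.elim v (fun i : F => u i)) ↔
      P (Sum.elim u v) := by
    intro u v
    rw [hφ]
    refine BoundedFormula.realize_restrictFreeVar _ ?_
    rintro ⟨a | b, h⟩
    · rfl
    · rfl
  refine ⟨φ'.iExs F, fun v => ?_⟩
  rw [Formula.realize_iExs]
  constructor
  · rintro ⟨u, hu⟩
    exact ⟨_, (key u v).2 hu⟩
  · rintro ⟨i, hi⟩
    let m : M := Classical.arbitrary M
    let u : α → M := fun a => if h : a ∈ F then i ⟨a, h⟩ else m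
    refine ⟨u, (key u v).1 ?_⟩
    have : (fun j : F => u j) = i := by
      funext j
      simp [u]
    rw [this]
    exact hi

theorem countable_formula (hL : L.card ≤ ℵ₀) (α : Type) [Countable α] : Countable (L.Formula α) := by
  have h : #(Σ n, L.BoundedFormula α n) ≤ ℵ₀ := by
    refine BoundedFormula.card_le.trans ?_
    simp only [max_le_iff, le_refl, true_and]
    have h1 : Cardinal.lift.{max u v} #α ≤ ℵ₀ := by
      rw [lift_le_aleph0]; exact mk_le_aleph0
    have h2 : Cardinal.lift.{0} L.card ≤ ℵ₀ := by
      rw [lift_le_aleph0]; exact hL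
    exact (add_le_add h1 h2).trans (by simp)
  have : Countable (Σ n, L.BoundedFormula α n) := mk_le_aleph0_iff.1 h
  exact Function.Injective.countable (f := fun φ : L.Formula α => (⟨0, φ⟩ : Σ n, L.BoundedFormula α n))
    (fun a b h => by simpa using h)

theorem LDef.countable (hL : L.card ≤ ℵ₀) (α : Type) [Countable α] :
    {P : (α → M) → Prop | LDef L P}.Countable := by
  have := countable_formula hL α
  refine (Set.countable_range (fun (φ : L.Formula α) (v : α → M) => φ.Realize v)).mono ?_
  rintro P ⟨φ, hφ⟩
  exact ⟨φ, funext fun v => propext (hφ v).symm⟩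

theorem LDef.sat1 (hsat : IsAleph1Saturated L M) {β : Type} [Countable β]
    (S : Set (M → (β → M) → Prop))
    (hS : ∀ P ∈ S, LDef L (fun w : Option β → M => P (w none) (fun i => w (some i))))
    (b : β → M) (h : ∀ s : Finset (M → (β → M) → Prop), ↑s ⊆ S → ∃ x, ∀ P ∈ s, P x b) :
    ∃ x, ∀ P ∈ S, P x b := by
  classical
  let A : Set M := Set.range b
  let p : Set (L.Formula (↥A ⊕ Fin 1)) := {φ | ∃ P ∈ S, ∀ x : Fin 1 → M, P (x 0) b ↔ φ.Realize (pval x)}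
  have hp : ∀ P ∈ S, ∃ φ ∈ p, ∀ x : Fin 1 → M, P (x 0) b ↔ φ.Realize (pval x) := by
    intro P hP
    obtain ⟨φ, hφ⟩ := hS P hP
    have : ∀ x : Fin 1 → M, P (x 0) b ↔ (φ.relabel (fun o : Option β =>
        (o.elim (Sum.inr 0) (fun i => Sum.inl ⟨b i, i, rfl⟩) : ↥A ⊕ Fin 1))).Realize (pval x) := by
      intro x
      rw [Formula.realize_relabel]
      have := hφ (fun o => o.elim (x 0) b)
      refine this.trans (iff_of_eq ?_)
      congr 1
      funext o
      cases o <;> rfl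
    exact ⟨_, ⟨P, hP, this⟩, this⟩
  obtain ⟨c, hc⟩ := hsat A (Set.countable_range b) p (by
    intro s hs
    choose! Q hQ1 hQ2 using fun φ (hφ : φ ∈ s) => hs hφ
    obtain ⟨x, hx⟩ := h (s.image Q) (by
      intro P hP
      simp only [Finset.coe_image, Set.mem_image, Finset.mem_coe] at hP
      obtain ⟨φ, hφ, rfl⟩ := hP
      exact hQ1 φ hφ)
    exact ⟨fun _ => x, fun φ hφ => (hQ2 φ hφ _).1 (hx _ (Finset.mem_image_of_mem Q hφ))⟩)
  refine ⟨c, fun P hP => ?_⟩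
  obtain ⟨φ, hφ, h⟩ := hp P hP
  exact (h ![c]).2 (hc φ hφ)

theorem LDef.satN [Nonempty M] (hsat : IsAleph1Saturated L M) {β : Type} [Countable β]
    (S : Set ((ℕ ⊕ β → M) → Prop)) (hS : ∀ P ∈ S, LDef L P) (b : β → M)
    (h : ∀ s : Finset ((ℕ ⊕ β → M) → Prop), ↑s ⊆ S → ∃ u : ℕ → M, ∀ P ∈ s, P (Sum.elim u b)) :
    ∃ u : ℕ → M, ∀ P ∈ S, P (Sum.elim u b) := by
  classical
  let FS : ℕ → (ℕ → M) → Prop := fun n u => ∀ s : Finset ((ℕ ⊕ β → M) → Prop), ↑s ⊆ S →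
    ∃ u' : ℕ → M, (∀ i, i < n → u' i = u i) ∧ ∀ P ∈ s, P (Sum.elim u' b)
  have step : ∀ n u, FS n u → ∃ x, FS (n+1) (Function.update u n x) := by
    intro n u hu
    let R : Finset ((ℕ ⊕ β → M) → Prop) → M → (ℕ ⊕ β → M) → Prop := fun s x d =>
      ∃ u' : ℕ → M, ((∀ i ∈ Finset.range n, u' i = d (Sum.inl i)) ∧ u' n = x) ∧
        ∀ P ∈ s, P (Sum.elim u' (fun j => d (Sum.inr j)))
    obtain ⟨x, hx⟩ := LDef.sat1 hsat {Q | ∃ s : Finset ((ℕ ⊕ β → M) → Prop), ↑s ⊆ S ∧ Q = R s} (by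
      rintro _ ⟨s, hs, rfl⟩
      have h1 : LDef L (fun W : ℕ ⊕ Option (ℕ ⊕ β) → M =>
          ((∀ i ∈ Finset.range n, W (Sum.inl i) = W (Sum.inr (some (Sum.inl i)))) ∧
          W (Sum.inl n) = W (Sum.inr none)) ∧ ∀ P ∈ s, P (fun k =>
            W (Sum.elim (fun i => Sum.inl i) (fun j => Sum.inr (some (Sum.inr j))) k))) :=
        ((LDef.fin_all _ fun i _ => LDef.eq _ _).and (LDef.eq _ _)).and
          (LDef.fin_all _ fun P hP => (hS P (hs hP)).rel _)
      refine h1.exs.congr' fun v => exists_congr fun u' => and_congr Iff.rfl ?_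
      refine forall_congr' fun P => imp_congr_right fun _ => iff_of_eq ?_
      congr 1
      funext k
      cases k <;> rfl) (Sum.elim u b) (by
      intro s hs
      choose! t ht1 ht2 using fun Q (hQ : Q ∈ s) => hs hQ
      obtain ⟨u', h1, h2⟩ := hu (s.biUnion t) (by
        intro P hP
        simp only [Finset.coe_biUnion, Set.mem_iUnion, Finset.mem_coe] at hP
        obtain ⟨Q, hQ, hP⟩ := hP
        exact ht1 Q hQ hP)
      refine ⟨u' n, fun Q hQ => ?_⟩
      rw [ht2 Q hQ]
      exact ⟨u', ⟨fun i hi => h1 i (Finset.mem_range.1 hi), rfl⟩, fun P hP =>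
        h2 P (Finset.mem_biUnion.2 ⟨Q, hQ, hP⟩)⟩)
    refine ⟨x, fun s hs => ?_⟩
    obtain ⟨u', ⟨h1, h2⟩, h3⟩ := hx _ ⟨s, hs, rfl⟩
    refine ⟨u', fun i hi => ?_, h3⟩
    by_cases hin : i = n
    · subst hin; simp [h2]
    · rw [Function.update_of_ne hin]
      exact h1 i (Finset.mem_range.2 (by omega))
  choose! X hX using step
  let u0 : ℕ → M := fun _ => Classical.arbitrary M
  let U : ℕ → ℕ → M := fun n => Nat.rec u0 (fun n u => Function.update u n (X n u)) n
  have hU : ∀ n, FS n (U n) := by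
    intro n
    induction n with
    | zero =>
      intro s hs
      obtain ⟨u', hu'⟩ := h s hs
      exact ⟨u', fun i hi => absurd hi (Nat.not_lt_zero i), hu'⟩
    | succ n ih => exact hX n _ ih
  have hstab : ∀ m n, m ≤ n → ∀ i, i < m → U n i = U m i := by
    intro m n hmn
    induction n, hmn using Nat.le_induction with
    | base => intros; rfl
    | succ n hmn ih =>
      intro i hi
      rw [← ih i hi]
      exact Function.update_of_ne (by omega) _ _
  let u : ℕ → M := fun i => U (i+1) i
  have hu : ∀ n i, i < n → U n i = u i := fun n i hi => hstab (i+1) n hi i (Nat.lt_succ_self i)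
  refine ⟨u, fun P hP => ?_⟩
  obtain ⟨F, hF⟩ := (hS P hP).supp
  let N := (F.toLeft.sup id) + 1
  obtain ⟨u', h1, h2⟩ := hU N {P} (by simpa using hP)
  refine (hF _ _ ?_).1 (h2 P (by simp))
  rintro (i | j) hi
  · have : i ≤ F.toLeft.sup id := Finset.le_sup (f := id) (Finset.mem_toLeft.2 hi)
    show u' i = u i
    rw [h1 i (by omega), hu N i (by omega)]
  · rfl

/-- The definable predicates of a saturated structure. -/
def LSys [Nonempty M] (hL : L.card ≤ ℵ₀) (hsat : IsAleph1Saturated L M) : DefSystem M where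
  Def P := LDef L P
  not' h := h.neg
  and' h h' := h.and h'
  rel' g _ h := h.rel g
  exs' h := h.exs
  eq' := LDef.eq _ _
  supp' h := h.supp
  countable' α _ := LDef.countable hL α
  sat' {α β} _ _ S hS b h := by
    classical
    obtain ⟨e, he⟩ := exists_injective_nat α
    let c : ((α ⊕ β → M) → Prop) → ((ℕ ⊕ β → M) → Prop) := fun P v =>
      P (fun k => v (Sum.map e id k))
    have hc : ∀ P u, c P (Sum.elim u b) ↔ P (Sum.elim (fun i => u (e i)) b) := by
      intro P u
      refine iff_of_eq ?_
      show P _ = P _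
      congr 1
      funext k
      cases k <;> rfl
    obtain ⟨u, hu⟩ := LDef.satN hsat (c '' S) (by
      rintro _ ⟨P, hP, rfl⟩
      exact (hS P hP).rel _) b (by
      intro s hs
      obtain ⟨s', hs', rfl⟩ := Finset.subset_set_image_iff.1 hs
      obtain ⟨x, hx⟩ := h s' hs'
      refine ⟨Function.extend e x (fun _ => Classical.arbitrary M), fun P hP => ?_⟩
      obtain ⟨P', hP', rfl⟩ := Finset.mem_image.1 hP
      rw [hc]
      have : (fun i => Function.extend e x (fun _ => Classical.arbitrary M) (e i)) = x :=
        funext fun i => he.extend_apply _ _ _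
      rw [this]
      exact hx P' hP')
    exact ⟨fun i => u (e i), fun P hP => (hc P u).1 (hu _ ⟨P, hP, rfl⟩)⟩

end ldef

section count
variable {L : FirstOrder.Language.{u, v}} {M : Type w} [L.Structure M] [Nonempty M]

theorem LDef.of_formula {α : Type} (φ : L.Formula α) : LDef L (fun v : α → M => φ.Realize v) :=
  ⟨φ, fun _ => Iff.rfl⟩

/-- An elementary enumeration gives a countable model. -/
theorem model_of_elem (hL : L.card ≤ ℵ₀) (hsat : IsAleph1Saturated L M) {T : L.Theory}
    [Infinite M] (hMT : T.Model M) (u : ℕ → M) (hu : ElemD (LSys hL hsat) u) :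
    ∃ (N : {N : Theory.ModelType.{u, v, 0} T // Countable N ∧ Infinite N}) (j : N.1 → M),
      Function.Injective j ∧ Set.range j = Set.range u ∧
      ∀ {α : Type} (φ : L.Formula α) (v : α → N.1), φ.Realize (j ∘ v) ↔ φ.Realize v := by
  classical
  let S : L.Substructure M :=
    { carrier := Set.range u
      fun_mem := by
        intro n f x hx
        choose g hg using hx
        obtain ⟨m, hm⟩ := hu (fun y w => y = Structure.funMap f (fun k => w (g k))) (by
          refine ⟨Term.equal (Term.var none)
            (Term.func f (fun k => Term.var (some (g k)))), fun v => ?_⟩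
          rw [Formula.realize_equal]
          simp) ⟨_, rfl⟩
        refine ⟨m, hm.trans ?_⟩
        congr 1
        funext k
        exact hg k }
  let S' : L.ElementarySubstructure M := S.toElementarySubstructure (by
    intro n φ x a h
    have hx : ∀ i, ∃ k, u k = (x i : M) := fun i => (x i).2
    choose g hg using hx
    let ψ : L.Formula (Fin (n+1)) := φ.toFormula.relabel (Sum.elim Empty.elim id)
    have hψ : ∀ w : Fin (n+1) → M, ψ.Realize w ↔ φ.Realize default w := by
      intro w
      rw [Formula.realize_relabel, BoundedFormula.realize_toFormula]
      refine iff_of_eq ?_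
      congr 1
      exact Subsingleton.elim _ _
    obtain ⟨m, hm⟩ := hu (fun y w => ψ.Realize (Fin.snoc (fun k => w (g k)) y)) (by
      refine ((LDef.of_formula ψ).rel (Fin.snoc (α := fun _ => Option ℕ)
        (fun k => some (g k)) none)).congr' fun v => ?_
      refine iff_of_eq ?_
      congr 1
      funext i
      refine Fin.lastCases ?_ (fun i => ?_) i <;> simp) ⟨a, by
        rw [hψ]
        convert h using 2
        funext k; exact hg k⟩
    refine ⟨⟨u m, m, rfl⟩, ?_⟩
    rw [hψ] at hm
    convert hm using 2
    funext k; exact (hg k).symm)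
  have hinf : (Set.range u).Infinite := by
    intro hfin
    have hF : ∃ F : Finset ℕ, ∀ k, ∃ i ∈ F, u i = u k := by
      refine ⟨hfin.toFinset.image (Function.invFun u), fun k => ⟨Function.invFun u (u k), ?_, ?_⟩⟩
      · exact Finset.mem_image_of_mem _ (by simp)
      · exact Function.invFun_eq ⟨k, rfl⟩
    obtain ⟨F, hF⟩ := hF
    obtain ⟨m, hm⟩ := hu (fun y w => ∀ k ∈ F, ¬ y = w k)
      (LDef.fin_all F fun k _ => (LDef.eq none (some k)).neg) (by
        obtain ⟨y, hy⟩ := Infinite.exists_notMem_finset (F.image u)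
        exact ⟨y, fun k hk h => hy (h ▸ Finset.mem_image_of_mem u hk)⟩)
    obtain ⟨i, hi, hi'⟩ := hF m
    exact hm i hi hi'.symm
  have hc : Countable S' := (Set.countable_range u).to_subtype
  have hi : Infinite S' := hinf.to_subtype
  obtain ⟨e⟩ : Nonempty (S' ≃ ℕ) := by
    obtain ⟨_⟩ := nonempty_denumerable_iff.2 ⟨hc, hi⟩
    exact ⟨Denumerable.eqv S'⟩
  have hT : T.Model S' := by
    have := S'.theory_model_iff T
    exact this.2 hMT
  let N : Theory.ModelType.{u, v, 0} T :=
    Theory.ModelType.equivInduced (M := Theory.ModelType.of T S') (N := ℕ) e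
  let _ : L.Structure ℕ := e.inducedStructure
  let e' : S' ≃[L] ℕ := e.inducedStructureEquiv
  refine ⟨⟨N, inferInstanceAs (Countable ℕ), inferInstanceAs (Infinite ℕ)⟩,
    fun n => (e.symm n : M), ?_, ?_, ?_⟩
  · exact Subtype.val_injective.comp e.symm.injective
  · ext y
    constructor
    · rintro ⟨n, rfl⟩
      exact (e.symm n).2
    · intro hy
      exact ⟨e ⟨y, hy⟩, by simp⟩
  · intro α φ v
    have h1 := S'.subtype.map_formula φ (e.symm ∘ v)
    have h2 := StrongHomClass.realize_formula e' φ (v := e.symm ∘ v)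
    have h3 : (e' : S' → ℕ) ∘ (e.symm ∘ v) = v := by
      funext i; exact e.apply_symm_apply _
    rw [h3] at h2
    exact h1.trans h2.symm

theorem counting (hL : L.card ≤ ℵ₀) (hsat : IsAleph1Saturated L M) {T : L.Theory}
    (hfew : numCountableModels T < 2 ^ ℵ₀)
    [Infinite M] (hMT : T.Model M) (u : (ℕ → Bool) → ℕ → M)
    (hu : ∀ s, ElemD (LSys hL hsat) (u s)) (a c : ∀ s, Set.range (u s))
    (hinj : ∀ s t (e : Set.range (u s) ≃ Set.range (u t)),
      (∀ {α : Type} (P : (α → M) → Prop), LDef L P → ∀ v : α → Set.range (u s),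
        P (fun i => v i) ↔ P (fun i => e (v i))) →
      e (a s) = a t → e (c s) = c t → s = t) : False := by
  classical
  choose N j hj hr hφ using fun s => model_of_elem hL hsat hMT (u s) (hu s)
  let Q := Quotient (countableModelSetoid T)
  let q : (ℕ → Bool) → Q := fun s => Quotient.mk _ (N s)
  have hiso : ∀ s (q' : Q), q' = q s → Nonempty ((N s).1 ≃[L] q'.out.1) := by
    rintro s _ rfl
    exact ((countableModelSetoid T).symm (Quotient.mk_out (N s)))
  have i' := fun s q' h => Classical.choice (hiso s q' h)
  have hen : ∀ q' : Q, ∃ f : q'.out.1 → ℕ, Function.Injective f := by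
    intro q'
    have := q'.out.2.1
    exact exists_injective_nat _
  choose en hen using hen
  let k : ∀ s, (N s).1 ≃ Set.range (u s) := fun s =>
    (Equiv.ofInjective (j s) (hj s)).trans (Equiv.setCongr (hr s))
  have hk : ∀ s x, (k s x : M) = j s x := fun s x => rfl
  let pt : ∀ s, Set.range (u s) → ℕ := fun s x => en (q s) (i' s (q s) rfl ((k s).symm x))
  let G : (ℕ → Bool) → Q × ℕ × ℕ := fun s => (q s, pt s (a s), pt s (c s))
  have hG : Function.Injective G := by
    intro s t hst
    simp only [G, Prod.mk.injEq] at hst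
    obtain ⟨h0, h1, h2⟩ := hst
    have key : ∀ q' (h : q' = q t) (x : (N t).1),
        en q' (i' t q' h x) = en (q t) (i' t (q t) rfl x) := by
      rintro _ rfl _; rfl
    let I : (N s).1 ≃[L] (N t).1 := (i' t (q s) h0).symm.comp (i' s (q s) rfl)
    let e : Set.range (u s) ≃ Set.range (u t) := ((k s).symm.trans I.toEquiv).trans (k t)
    have hpt : ∀ x y, pt s x = pt t y → e x = y := by
      intro x y hxy
      have := hen (q s) (hxy.trans (key _ h0 _).symm)
      show k t ((i' t (q s) h0).symm (i' s (q s) rfl ((k s).symm x))) = y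
      rw [this]
      simp
    refine hinj s t e ?_ (hpt _ _ h1) (hpt _ _ h2)
    rintro α P ⟨φ, hP⟩ v
    rw [hP, hP]
    have e1 := hφ s φ (fun i => (k s).symm (v i))
    have e2 := StrongHomClass.realize_formula I φ (v := fun i => (k s).symm (v i))
    have e3 := hφ t φ (I ∘ fun i => (k s).symm (v i))
    have h4 : (j s ∘ fun i => (k s).symm (v i)) = fun i => (v i : M) := by
      funext i
      show j s ((k s).symm (v i)) = _
      rw [← hk, Equiv.apply_symm_apply]
    rw [h4] at e1
    exact e1.trans (e2.symm.trans e3.symm)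
  have hcard := Cardinal.lift_mk_le_lift_mk_of_injective hG
  have h2 : #(Q × ℕ × ℕ) < 2 ^ ℵ₀ := by
    rw [Cardinal.mk_prod]
    refine Cardinal.mul_lt_of_lt (Cardinal.cantor' _ (by simp) |>.le) ?_ ?_
    · rw [Cardinal.lift_id']; exact hfew
    · simpa using Cardinal.cantor ℵ₀
  have h3 : Cardinal.lift.{max u v 1} #(ℕ → Bool) = 2 ^ ℵ₀ := by simp
  have h4 : Cardinal.lift.{0} #(Q × ℕ × ℕ) = #(Q × ℕ × ℕ) := Cardinal.lift_id' _
  rw [h4] at hcard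
  refine absurd h2 (not_lt.2 (le_trans (le_of_eq ?_) hcard))
  simp

end count

section noframe
variable {L : FirstOrder.Language.{u, v}} {M : Type w} [L.Structure M] [Nonempty M]

/-- The definable predicates with one named parameter. -/
def PSys (hL : L.card ≤ ℵ₀) (hsat : IsAleph1Saturated L M) (a : M) : DefSystem M :=
  (LSys hL hsat).name id Function.surjective_id (fun _ : Unit => a)

theorem PSys_transfer (hL : L.card ≤ ℵ₀) (hsat : IsAleph1Saturated L M) (a : M)
    {α : Type} {P : (α → M) → Prop} (hP : (PSys hL hsat a).Def P)
    {A B : Set M} (e : A → B) (he : ∀ {α : Type} (P : (α → M) → Prop), LDef L P → ∀ v : α → A,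
        P (fun i => v i) ↔ P (fun i => e (v i))) (x : A) (hx : (x : M) = a) (hex : (e x : M) = a)
    (v : α → A) : P (fun i => v i) ↔ P (fun i => e (v i)) := by
  obtain ⟨P', h1, h2⟩ := hP
  rw [h2, h2]
  have := he _ h1 (Sum.elim v (fun _ => x))
  simpa [hx, hex] using this

theorem PSys_elem (hL : L.card ≤ ℵ₀) (hsat : IsAleph1Saturated L M) (a : M) {u : ℕ → M}
    (hu : ElemD (PSys hL hsat a) u) : ElemD (LSys hL hsat) u ∧ a ∈ Set.range u := by
  refine ⟨fun P hP hx => hu P (DefSystem.name_of _ _ _ _ hP) hx, ?_⟩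
  obtain ⟨m, hm⟩ := hu (fun x _ => x = a) ⟨fun v d => v none = d (), LDef.eq _ _, fun _ => Iff.rfl⟩
    ⟨a, rfl⟩
  exact ⟨m, hm⟩

theorem exists_elem2 (hL : L.card ≤ ℵ₀) (hsat : IsAleph1Saturated L M) (a c : M) :
    ∃ u, ElemD (LSys hL hsat) u ∧ a ∈ Set.range u ∧ c ∈ Set.range u := by
  obtain ⟨u, -, hu⟩ := ((LSys hL hsat).name id Function.surjective_id
    (fun b : Bool => bif b then c else a)).henkin Set.univ
    (fun B hB hx => ⟨B, hB, hx, fun x hx => ⟨hx, trivial⟩⟩)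
  refine ⟨u, fun P hP hx => hu P (DefSystem.name_of _ _ _ _ hP) hx, ?_, ?_⟩
  · obtain ⟨m, hm⟩ := hu (fun x _ => x = a)
      ⟨fun v d => v none = d false, LDef.eq _ _, fun _ => Iff.rfl⟩ ⟨a, rfl⟩
    exact ⟨m, hm⟩
  · obtain ⟨m, hm⟩ := hu (fun x _ => x = c)
      ⟨fun v d => v none = d true, LDef.eq _ _, fun _ => Iff.rfl⟩ ⟨c, rfl⟩
    exact ⟨m, hm⟩

theorem no_frame (hL : L.card ≤ ℵ₀) (hsat : IsAleph1Saturated L M) {T : L.Theory}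
    (hfew : numCountableModels T < 2 ^ ℵ₀)
    [Infinite M] (hMT : T.Model M) (a : M) {X : Type w'} [LinearOrder X] (π : M → X)
    (hπ : Function.Surjective π) (hk : (PSys hL hsat a).Def2 (fun x y => π x = π y))
    (nat : ℕ → X) (H : Frame ((PSys hL hsat a).map π hπ hk) nat) : False := by
  rcases dichotomy H with ⟨F, hF⟩ | ⟨χ, r, hr, hk', nat', H', S'⟩
  · choose c hc using fun f => hπ (F f)
    choose u hu ha hcu using fun f => exists_elem2 hL hsat a (c f)
    refine counting hL hsat hfew hMT u hu (fun s => ⟨a, ha s⟩) (fun s => ⟨c s, hcu s⟩) ?_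
    intro s t e he h1 h2
    refine hF s t fun B hB => ?_
    have := PSys_transfer hL hsat a hB e he ⟨a, ha s⟩ rfl (congrArg Subtype.val h1)
      (fun _ => ⟨c s, hcu s⟩)
    rw [h2] at this
    simpa [hc] using this
  · have hk2 : (PSys hL hsat a).Def2 (fun x y => (r ∘ π) x = (r ∘ π) y) := hk'
    have H2 : Frame ((PSys hL hsat a).map (r ∘ π) (hr.comp hπ) hk2) nat' := H'
    have S2 : Star ((PSys hL hsat a).map (r ∘ π) (hr.comp hπ) hk2) nat' := S'
    choose u b hm using fun f : ℕ → Bool => exists_mdl H2 S2 (Shuf (shufc f))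
    have hu := fun f => PSys_elem hL hsat a (hm f).elem
    refine counting hL hsat hfew hMT u (fun f => (hu f).1) (fun s => ⟨a, (hu s).2⟩)
      (fun s => ⟨a, (hu s).2⟩) ?_
    intro s t e he h1 _
    refine shuf_inj (orderIso_of H2 S2 (hm s) (hm t) e fun P hP x y => ?_)
    exact PSys_transfer hL hsat a hP e he ⟨a, (hu s).2⟩ rfl (congrArg Subtype.val h1)
      (fun b => bif b then y else x)

end noframe

/-- A definable linear preorder with an initial segment of type omega gives a frame. -/
theorem frame_of {Y : Type w} (D : DefSystem Y) (Ds : Y → Prop) (hDs : D.Def1 Ds)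
    (le : Y → Y → Prop) (hle : D.Def2 le) (hrefl : ∀ x, Ds x → le x x)
    (htrans : ∀ x y z, Ds x → Ds y → Ds z → le x y → le y z → le x z)
    (htotal : ∀ x y, Ds x → Ds y → le x y ∨ le y x)
    (s : ℕ → Y) (hs : ∀ n, Ds (s n)) (hmono : ∀ n, ¬ le (s (n+1)) (s n))
    (hinit : ∀ x, Ds x → ∀ n, le x (s n) → ∃ m, le x (s m) ∧ le (s m) x)
    (hs0 : D.Def1 (fun x => x = s 0)) :
    ∃ (X : Type w) (_ : LinearOrder X) (π : Y → X) (hπ : Function.Surjective π)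
      (hk : D.Def2 (fun x y => π x = π y)) (nat : ℕ → X), Frame (D.map π hπ hk) nat := by
  classical
  letI pre : Preorder {x // Ds x} :=
    { le := fun x y => le x y
      le_refl := fun x => hrefl x x.2
      le_trans := fun x y z => htrans x y z x.2 y.2 z.2 }
  haveI : Std.Total (α := {x // Ds x}) (· ≤ ·) := ⟨fun x y => htotal x y x.2 y.2⟩
  let ρ : Y → {x // Ds x} := fun x => if h : Ds x then ⟨x, h⟩ else ⟨s 0, hs 0⟩
  have hρ1 : ∀ x : {x // Ds x}, ρ x = x := fun x => by simp [ρ, x.2]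
  let π : Y → Antisymmetrization {x // Ds x} (· ≤ ·) := fun x => toAntisymmetrization _ (ρ x)
  have hπle : ∀ x y, π x ≤ π y ↔ le (ρ x) (ρ y) := fun x y => Iff.rfl
  have hρ : D.Fn (fun v : Unit → Y => (ρ (v ()) : Y)) := by
    refine D.congr (D.or (D.and' (D.sub1 hDs (D.var (some ()))) (D.eqd none (some ())))
      (D.and' (D.not' (D.sub1 hDs (D.var (some ())))) (D.sub1 hs0 (D.var none)))) fun v => ?_
    by_cases h : Ds (v (some ())) <;> simp [ρ, h]
  have hρ' : ∀ {α : Type} (i : α), D.Fn (fun v : α → Y => (ρ (v i) : Y)) := fun i =>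
    DefSystem.Fn.comp D (t := fun v _ => v i) hρ (fun _ => D.var i)
  have hl : ∀ {α : Type} (i j : α), D.Def (fun v : α → Y => π (v i) ≤ π (v j)) := fun i j =>
    D.sub2 hle (hρ' i) (hρ' j)
  have hπs : Function.Surjective π := by
    intro x
    induction x using Antisymmetrization.ind with
    | _ x => exact ⟨x, by simp only [π, hρ1]⟩
  have hk : D.Def2 (fun x y => π x = π y) :=
    D.congr (D.and' (hl false true) (hl true false)) fun v => le_antisymm_iff.symm
  refine ⟨_, inferInstance, π, hπs, hk, fun n => π (s n), ?_, ?_, ?_⟩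
  · show D.Def _
    exact D.congr (D.not' (hl true false)) fun v => not_le
  · refine strictMono_nat_of_lt_succ fun n => not_le.1 ?_
    rw [hπle]
    rw [hρ1 ⟨_, hs n⟩, hρ1 ⟨_, hs (n+1)⟩]
    exact hmono n
  · intro x n hx
    obtain ⟨y, rfl⟩ := hπs x
    rw [hπle, hρ1 ⟨_, hs n⟩] at hx
    obtain ⟨m, h1, h2⟩ := hinit _ (ρ y).2 n hx
    refine ⟨m, le_antisymm ?_ ?_⟩
    · rw [hπle, hρ1 ⟨_, hs m⟩]; exact h1
    · rw [hπle, hρ1 ⟨_, hs m⟩]; exact h2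

section red
variable {L : FirstOrder.Language.{u, v}} {M : Type w} [L.Structure M] [Nonempty M]

theorem LDef.of_pval {n : ℕ} (φ : L.Formula (↥(∅ : Set M) ⊕ Fin n)) :
    LDef L (fun v : Fin n → M => φ.Realize (pval v)) := by
  refine ⟨φ.relabel (Sum.elim (fun x => (x.2 : False).elim) id), fun v => ?_⟩
  rw [Formula.realize_relabel]
  refine iff_of_eq ?_
  show φ.Realize _ = φ.Realize _
  congr 1
  funext i
  rcases i with ⟨_, h⟩ | i
  · exact h.elim
  · rfl

theorem LDef.defRel2 (φ : L.Formula (↥(∅ : Set M) ⊕ Fin 2)) :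
    LDef L (fun v : Bool → M => defRel ∅ φ (v false) (v true)) := by
  refine ((LDef.of_pval φ).rel ![false, true]).congr' fun v => ?_
  refine iff_of_eq ?_
  show φ.Realize _ = φ.Realize _
  congr 2
  funext i
  fin_cases i <;> rfl

theorem LDef.type1 (φ : L.Formula (↥(∅ : Set M) ⊕ Fin 1)) :
    LDef L (fun v : Unit → M => φ.Realize (pval ![v ()])) := by
  refine ((LDef.of_pval φ).rel (fun _ => ())).congr' fun v => ?_
  refine iff_of_eq ?_
  show φ.Realize _ = φ.Realize _
  congr 2
  funext i
  fin_cases i; rfl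

variable (hL : L.card ≤ ℵ₀) (hsat : IsAleph1Saturated L M)
  {p : Set (L.Formula (↥(∅ : Set M) ⊕ Fin 1))} (hcomp : IsCompleteType ∅ p)

include hcomp in
theorem same_type {a b : M} (ha : a ∈ typeSet ∅ p) (hb : b ∈ typeSet ∅ p) (B : M → Prop)
    (hB : (LSys hL hsat).Def1 B) : B a ↔ B b := by
  obtain ⟨φ, hφ⟩ := hB
  let φ' : L.Formula (↥(∅ : Set M) ⊕ Fin 1) := φ.relabel (fun _ => Sum.inr 0)
  have h : ∀ x, B x ↔ φ'.Realize (pval ![x]) := by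
    intro x
    rw [Formula.realize_relabel]
    exact hφ (fun _ => x)
  rcases hcomp.2 φ' with h' | h'
  · exact iff_of_true ((h a).2 (ha _ h')) ((h b).2 (hb _ h'))
  · refine iff_of_false (fun hh => ?_) (fun hh => ?_)
    · exact (Formula.realize_not.1 (ha _ h')) ((h a).1 hh)
    · exact (Formula.realize_not.1 (hb _ h')) ((h b).1 hh)

theorem mem_of_def1 {x : M} (hx : ∀ B, (LSys hL hsat).Def1 B → (∀ y ∈ typeSet ∅ p, B y) → B x) :
    x ∈ typeSet ∅ p := by
  intro φ hφ
  exact hx (fun y => φ.Realize (pval ![y])) (LDef.type1 φ) (fun y hy => hy φ hφ)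

include hcomp in
theorem homog {a b : M} (ha : a ∈ typeSet ∅ p) (hb : b ∈ typeSet ∅ p) (c : M)
    (hc : c ∈ typeSet ∅ p) :
    ∃ c' ∈ typeSet ∅ p, ∀ Q, (LSys hL hsat).Def2 Q → (Q a c' ↔ Q b c) := by
  classical
  obtain ⟨c', hc'⟩ := (LSys hL hsat).sat1
    {R : M → (Unit → M) → Prop | (LSys hL hsat).DefO R ∧ R c (fun _ => b)} (fun R hR => hR.1)
    (fun _ => a) (by
    intro t ht
    have := same_type hL hsat hcomp ha hb (fun y => ∃ x, ∀ R ∈ t, R x (fun _ => y)) (by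
      refine (LSys hL hsat).ex (P := fun x v => ∀ R ∈ t, R x (fun _ => v ())) ?_
      exact (LSys hL hsat).fin_all t fun R hR => (ht hR).1)
    exact this.2 ⟨c, fun R hR => (ht hR).2⟩)
  have key : ∀ Q, (LSys hL hsat).Def2 Q → Q b c → Q a c' := by
    intro Q hQ h
    exact hc' (fun x v => Q (v ()) x) ⟨(LSys hL hsat).sub2 hQ ((LSys hL hsat).var _)
      ((LSys hL hsat).var _), h⟩
  refine ⟨c', ?_, fun Q hQ => ⟨fun h => ?_, key Q hQ⟩⟩
  · refine mem_of_def1 hL hsat fun B hB hP => ?_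
    exact key (fun _ y => B y) ((LSys hL hsat).sub1 hB ((LSys hL hsat).var _)) (hP c hc)
  · by_contra hn
    exact key (fun x y => ¬ Q x y) ((LSys hL hsat).not' hQ) hn h

theorem cpt {α β : Type} [Finite α] [Countable β] {Φ : (α → M) → (β → M) → Prop}
    (hΦ : (LSys hL hsat).DefS Φ) (d : β → M)
    (h : ∀ x : α → M, (∀ i, x i ∈ typeSet ∅ p) → Φ x d) :
    ∃ θ, (LSys hL hsat).Def1 θ ∧ (∀ y ∈ typeSet ∅ p, θ y) ∧
      ∀ x : α → M, (∀ i, θ (x i)) → Φ x d := by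
  classical
  by_contra hcon
  push Not at hcon
  let D := LSys hL hsat
  let S0 : Set (M → Prop) := {θ | D.Def1 θ ∧ ∀ y ∈ typeSet ∅ p, θ y}
  let W : (M → Prop) → ((α ⊕ β → M) → Prop) := fun θ w =>
    (∀ i, θ (w (Sum.inl i))) ∧ ¬ Φ (fun i => w (Sum.inl i)) (fun i => w (Sum.inr i))
  obtain ⟨x, hx⟩ := D.sat' (W '' S0) (by
    rintro _ ⟨θ, hθ, rfl⟩
    exact D.and' (D.finite_all fun i => D.sub1 hθ.1 (D.var _)) (D.not' hΦ)) d (by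
    intro t ht
    obtain ⟨t', ht', rfl⟩ := Finset.subset_set_image_iff.1 ht
    obtain ⟨x, h1, h2⟩ := hcon (fun y => ∀ θ ∈ t', θ y) (D.fin_all t' fun θ hθ => (ht' hθ).1)
      (fun y hy θ hθ => (ht' hθ).2 y hy)
    refine ⟨x, fun Q hQ => ?_⟩
    obtain ⟨θ, hθ, rfl⟩ := Finset.mem_image.1 hQ
    exact ⟨fun i => h1 i θ hθ, h2⟩)
  have h0 : ∀ θ, D.Def1 θ → (∀ y ∈ typeSet ∅ p, θ y) → W θ (Sum.elim x d) := fun θ h1 h2 =>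
    hx _ ⟨θ, ⟨h1, h2⟩, rfl⟩
  refine (h0 (fun _ => True) D.tt' (fun _ _ => trivial)).2 (h x fun i => ?_)
  exact mem_of_def1 hL hsat fun B hB hB' => (h0 B hB hB').1 i

end red

/-- Corollary 11. If `T` has fewer than `2 ^ ℵ₀` countable
models, `<` is a relatively ∅-definable linear order on `p(M)`, and `E` is a
relatively ∅-definable convex equivalence relation on `p(M)` with infinitely many
classes, then the quotient order `(p(M)/E, <)` is dense and endless. -/
theorem statement18 (L : FirstOrder.Language.{u, v}) (hL : L.card ≤ ℵ₀)
    (T : L.Theory) (hT : T.IsComplete)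
    (hfew : numCountableModels T < 2 ^ ℵ₀)
    (M : Type w) [L.Structure M] (hMT : M ⊨ T) (hMinf : Infinite M)
    (hsat : IsAleph1Saturated L M)
    (p : Set (L.Formula (↥(∅ : Set M) ⊕ Fin 1)))
    (hcomp : IsCompleteType (∅ : Set M) p)
    (φp : L.Formula (↥(∅ : Set M) ⊕ Fin 2))
    (r : M → M → Prop)
    (hr : r = fun a b => a ∈ typeSet (∅ : Set M) p ∧ b ∈ typeSet (∅ : Set M) p ∧
      defRel (∅ : Set M) φp a b)
    (hlin : IsLinearOn r (typeSet (∅ : Set M) p))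
    (ψ : L.Formula (↥(∅ : Set M) ⊕ Fin 2))
    (E : M → M → Prop)
    (hE : E = fun a b => a ∈ typeSet (∅ : Set M) p ∧ b ∈ typeSet (∅ : Set M) p ∧
      defRel (∅ : Set M) ψ a b)
    (hErefl : ∀ a ∈ typeSet (∅ : Set M) p, E a a)
    (hEsymm : ∀ a b : M, E a b → E b a)
    (hEtrans : ∀ a b c : M, E a b → E b c → E a c)
    (hEconvex : ∀ a b c : M, a ∈ typeSet (∅ : Set M) p → b ∈ typeSet (∅ : Set M) p →
      c ∈ typeSet (∅ : Set M) p → E a b → r a c → r c b → E a c)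
    (hEinf : ∃ g : ℕ → M, (∀ i : ℕ, g i ∈ typeSet (∅ : Set M) p) ∧
      ∀ i j : ℕ, i ≠ j → ¬E (g i) (g j)) :
    (∀ a b : M, a ∈ typeSet (∅ : Set M) p → b ∈ typeSet (∅ : Set M) p →
      r a b → ¬E a b →
      ∃ c ∈ typeSet (∅ : Set M) p, (r a c ∧ ¬E a c) ∧ (r c b ∧ ¬E c b)) ∧
    (∀ a ∈ typeSet (∅ : Set M) p, ∃ c ∈ typeSet (∅ : Set M) p, r c a ∧ ¬E c a) ∧
    (∀ a ∈ typeSet (∅ : Set M) p, ∃ c ∈ typeSet (∅ : Set M) p, r a c ∧ ¬E a c) := by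
  classical
  have hne : Nonempty M := inferInstance
  let D := LSys hL hsat
  set P := typeSet (∅ : Set M) p with hPdef
  let R : M → M → Prop := defRel ∅ φp
  let Q : M → M → Prop := defRel ∅ ψ
  have hR : D.Def2 R := LDef.defRel2 φp
  have hQ : D.Def2 Q := LDef.defRel2 ψ
  have rR : ∀ x y, x ∈ P → y ∈ P → (r x y ↔ R x y) := by
    intro x y hx hy; rw [hr]; exact ⟨fun h => h.2.2, fun h => ⟨hx, hy, h⟩⟩
  have eQ : ∀ x y, x ∈ P → y ∈ P → (E x y ↔ Q x y) := by
    intro x y hx hy; rw [hE]; exact ⟨fun h => h.2.2, fun h => ⟨hx, hy, h⟩⟩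
  let S : M → M → Prop := fun x y => R x y ∧ ¬ Q x y
  have hS : D.Def2 S := D.and' hR (D.not' hQ)
  have sS : ∀ x y, x ∈ P → y ∈ P → ((r x y ∧ ¬ E x y) ↔ S x y) := by
    intro x y hx hy
    exact and_congr (rR x y hx hy) (not_congr (eQ x y hx hy))
  have hpair : ∃ b0 ∈ P, ∃ b1 ∈ P, S b0 b1 := by
    obtain ⟨g, hg, hgE⟩ := hEinf
    rcases hlin.2.2 (g 0) (hg 0) (g 1) (hg 1) with h | h | h
    · exact (hgE 0 1 (by simp) (h ▸ hErefl _ (hg 0))).elim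
    · exact ⟨g 0, hg 0, g 1, hg 1, (sS _ _ (hg 0) (hg 1)).1 ⟨h, hgE 0 1 (by simp)⟩⟩
    · exact ⟨g 1, hg 1, g 0, hg 0, (sS _ _ (hg 1) (hg 0)).1 ⟨h, hgE 1 0 (by simp)⟩⟩
  have hS' : D.Def2 (fun x y => S y x) := D.sub2 hS (D.var true) (D.var false)
  obtain ⟨b0, hb0, b1, hb1, hb⟩ := hpair
  refine ⟨?_, fun a ha => ?_, fun a ha => ?_⟩
  rotate_left
  · obtain ⟨c, hc, h⟩ := homog hL hsat hcomp ha hb1 b0 hb0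
    exact ⟨c, hc, (sS _ _ hc ha).2 ((h _ hS').2 hb)⟩
  · obtain ⟨c, hc, h⟩ := homog hL hsat hcomp ha hb0 b1 hb1
    exact ⟨c, hc, (sS _ _ ha hc).2 ((h _ hS).2 hb)⟩
  intro a b ha hb hab hnab
  by_contra hcon
  have hSab : S a b := (sS a b ha hb).1 ⟨hab, hnab⟩
  have hno : ∀ z ∈ P, ¬ (S a z ∧ S z b) := fun z hz h =>
    hcon ⟨z, hz, (sS _ _ ha hz).2 h.1, (sS _ _ hz hb).2 h.2⟩
  -- a formula isolating the relevant behaviour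
  let Φ : (Fin 3 → M) → (Bool → M) → Prop := fun x d =>
    ¬ R (x 0) (x 0) ∧ (R (x 0) (x 1) → R (x 1) (x 2) → R (x 0) (x 2)) ∧
    (x 0 = x 1 ∨ R (x 0) (x 1) ∨ R (x 1) (x 0)) ∧
    Q (x 0) (x 0) ∧ (Q (x 0) (x 1) → Q (x 1) (x 0)) ∧
    (Q (x 0) (x 1) → Q (x 1) (x 2) → Q (x 0) (x 2)) ∧
    (Q (x 0) (x 1) → R (x 0) (x 2) → R (x 2) (x 1) → Q (x 0) (x 2)) ∧
    ¬ (S (d false) (x 0) ∧ S (x 0) (d true))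
  have hΦ : D.DefS Φ := by
    have r2 : ∀ i j : Fin 3, D.Def (fun w : Fin 3 ⊕ Bool → M => R (w (Sum.inl i)) (w (Sum.inl j))) :=
      fun i j => D.sub2 hR (D.var _) (D.var _)
    have q2 : ∀ i j : Fin 3, D.Def (fun w : Fin 3 ⊕ Bool → M => Q (w (Sum.inl i)) (w (Sum.inl j))) :=
      fun i j => D.sub2 hQ (D.var _) (D.var _)
    exact D.and' (D.not' (r2 0 0)) <| D.and' (D.imp (r2 0 1) (D.imp (r2 1 2) (r2 0 2))) <|
      D.and' (D.or (D.eqd _ _) (D.or (r2 0 1) (r2 1 0))) <| D.and' (q2 0 0) <|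
      D.and' (D.imp (q2 0 1) (q2 1 0)) <| D.and' (D.imp (q2 0 1) (D.imp (q2 1 2) (q2 0 2))) <|
      D.and' (D.imp (q2 0 1) (D.imp (r2 0 2) (D.imp (r2 2 1) (q2 0 2)))) <|
      D.not' (D.and' (D.sub2 hS (D.var _) (D.var _)) (D.sub2 hS (D.var _) (D.var _)))
  obtain ⟨θ, hθ, hPθ, hθΦ⟩ := cpt (p := p) hL hsat hΦ (fun i => bif i then b else a) (by
    intro x hx
    have hx0 := hx 0
    have hx1 := hx 1
    have hx2 := hx 2
    refine ⟨?_, ?_, ?_, ?_, ?_, ?_, ?_, ?_⟩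
    · rw [← rR _ _ hx0 hx0]; exact hlin.1 _ hx0
    · rw [← rR _ _ hx0 hx1, ← rR _ _ hx1 hx2, ← rR _ _ hx0 hx2]
      exact hlin.2.1 _ hx0 _ hx1 _ hx2
    · rw [← rR _ _ hx0 hx1, ← rR _ _ hx1 hx0]; exact hlin.2.2 _ hx0 _ hx1
    · rw [← eQ _ _ hx0 hx0]; exact hErefl _ hx0
    · rw [← eQ _ _ hx0 hx1, ← eQ _ _ hx1 hx0]; exact hEsymm _ _
    · rw [← eQ _ _ hx0 hx1, ← eQ _ _ hx1 hx2, ← eQ _ _ hx0 hx2]; exact hEtrans _ _ _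
    · rw [← eQ _ _ hx0 hx1, ← rR _ _ hx0 hx2, ← rR _ _ hx2 hx1, ← eQ _ _ hx0 hx2]
      exact hEconvex _ _ _ hx0 hx1 hx2
    · exact hno _ hx0)
  have hθ3 : ∀ x y z, θ x → θ y → θ z → Φ ![x, y, z] (fun i => bif i then b else a) := by
    intro x y z hx hy hz
    refine hθΦ _ fun i => ?_
    fin_cases i
    exacts [hx, hy, hz]
  have irr : ∀ x, θ x → ¬ R x x := fun x hx => (hθ3 x x x hx hx hx).1
  have tr : ∀ x y z, θ x → θ y → θ z → R x y → R y z → R x z := fun x y z hx hy hz =>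
    (hθ3 x y z hx hy hz).2.1
  have tot : ∀ x y, θ x → θ y → x = y ∨ R x y ∨ R y x := fun x y hx hy =>
    (hθ3 x y x hx hy hx).2.2.1
  have qre : ∀ x, θ x → Q x x := fun x hx => (hθ3 x x x hx hx hx).2.2.2.1
  have qsy : ∀ x y, θ x → θ y → Q x y → Q y x := fun x y hx hy => (hθ3 x y x hx hy hx).2.2.2.2.1
  have qtr : ∀ x y z, θ x → θ y → θ z → Q x y → Q y z → Q x z := fun x y z hx hy hz =>
    (hθ3 x y z hx hy hz).2.2.2.2.2.1
  have qcv : ∀ x y z, θ x → θ y → θ z → Q x y → R x z → R z y → Q x z := fun x y z hx hy hz =>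
    (hθ3 x y z hx hy hz).2.2.2.2.2.2.1
  have nob : ∀ x, θ x → ¬ (S a x ∧ S x b) := fun x hx => (hθ3 x x x hx hx hx).2.2.2.2.2.2.2
  let le : M → M → Prop := fun x y => Q x y ∨ R x y
  have hle : D.Def2 le := D.or hQ hR
  have letr : ∀ x y z, θ x → θ y → θ z → le x y → le y z → le x z := by
    rintro x y z hx hy hz (h | h) (h' | h')
    · exact Or.inl (qtr x y z hx hy hz h h')
    · rcases tot x z hx hz with rfl | h1 | h1
      · exact Or.inl (qre x hx)
      · exact Or.inr h1
      · exact Or.inl (qtr x y z hx hy hz h (qcv y x z hy hx hz (qsy x y hx hy h) h' h1))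
    · rcases tot x z hx hz with rfl | h1 | h1
      · exact Or.inl (qre x hx)
      · exact Or.inr h1
      · exact Or.inl (qsy z x hz hx (qcv z y x hz hy hx (qsy y z hy hz h') h1 h))
    · exact Or.inr (tr x y z hx hy hz h h')
  have letot : ∀ x y, θ x → θ y → le x y ∨ le y x := by
    intro x y hx hy
    rcases tot x y hx hy with rfl | h | h
    · exact Or.inl (Or.inl (qre x hx))
    · exact Or.inl (Or.inr h)
    · exact Or.inr (Or.inr h)
  have notle : ∀ x y, θ x → θ y → ¬ le x y → S y x := by
    intro x y hx hy h
    rcases letot x y hx hy with h1 | h1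
    · exact (h h1).elim
    · have hq : ¬ Q y x := fun hq => h (Or.inl (qsy y x hy hx hq))
      exact ⟨h1.resolve_left hq, hq⟩
  have Snotle : ∀ x y, θ x → θ y → S y x → ¬ le x y := by
    rintro x y hx hy ⟨h1, h2⟩ (h | h)
    · exact h2 (qsy x y hx hy h)
    · exact irr x hx (tr x y x hx hy hx h h1)
  -- the successor sequence
  have hstep : ∀ x, x ∈ P → ∃ y, y ∈ P ∧ ∀ Q', D.Def2 Q' → (Q' x y ↔ Q' a b) := by
    intro x hx
    obtain ⟨y, hy, h⟩ := homog hL hsat hcomp hx ha b hb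
    exact ⟨y, hy, h⟩
  choose! f hf1 hf2 using hstep
  let s : ℕ → M := fun n => f^[n] a
  have hs1 : ∀ n, s (n+1) = f (s n) := fun n => Function.iterate_succ_apply' f n a
  have hsP : ∀ n, s n ∈ P := by
    intro n
    induction n with
    | zero => exact ha
    | succ n ih => rw [hs1]; exact hf1 _ ih
  have hsθ : ∀ n, θ (s n) := fun n => hPθ _ (hsP n)
  have hsS : ∀ n, S (s n) (s (n+1)) := by
    intro n
    rw [hs1]
    exact (hf2 _ (hsP n) S hS).2 hSab
  have hsN : ∀ n z, θ z → ¬ (S (s n) z ∧ S z (s (n+1))) := by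
    intro n
    rw [hs1]
    refine (hf2 _ (hsP n) (fun x y => ∀ z, θ z → ¬ (S x z ∧ S z y)) ?_).2 nob
    refine D.all (P := fun z (v : Bool → M) => θ z → ¬ (S (v false) z ∧ S z (v true))) ?_
    exact D.imp (D.sub1 hθ (D.var _)) (D.not' (D.and' (D.sub2 hS (D.var _) (D.var _))
      (D.sub2 hS (D.var _) (D.var _))))
  have hinit : ∀ x, θ x → le a x → ∀ n, le x (s n) → ∃ m, le x (s m) ∧ le (s m) x := by
    intro x hx hax n
    induction n with
    | zero => exact fun h => ⟨0, h, hax⟩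
    | succ n ih =>
      intro h
      by_cases h1 : le x (s n)
      · exact ih h1
      · by_cases h2 : le (s (n+1)) x
        · exact ⟨n+1, h, h2⟩
        · exact (hsN n x hx ⟨notle _ _ hx (hsθ n) h1, notle _ _ (hsθ (n+1)) hx h2⟩).elim
  have has : ∀ n, le a (s n) := by
    intro n
    induction n with
    | zero => exact Or.inl (qre a (hPθ a ha))
    | succ n ih => exact letr _ _ _ (hPθ a ha) (hsθ n) (hsθ (n+1)) ih (Or.inr (hsS n).1)
  let D' := PSys hL hsat a
  have up : ∀ {α : Type} {A : (α → M) → Prop}, D.Def A → D'.Def A := fun h =>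
    DefSystem.name_of _ _ _ _ h
  have ha1 : D'.Def1 (fun x => x = a) := ⟨fun v d => v () = d (), LDef.eq _ _, fun _ => Iff.rfl⟩
  have hDs : D'.Def1 (fun x => θ x ∧ le a x) := D'.and' (up hθ)
    ⟨fun v d => le (d ()) (v ()), D.sub2 hle (D.var _) (D.var _), fun _ => Iff.rfl⟩
  obtain ⟨X, hX, π, hπ, hk, nat, H⟩ := frame_of D' (fun x => θ x ∧ le a x) hDs le (up hle)
    (fun x hx => Or.inl (qre x hx.1)) (fun x y z hx hy hz => letr x y z hx.1 hy.1 hz.1)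
    (fun x y hx hy => letot x y hx.1 hy.1) s (fun n => ⟨hsθ n, has n⟩)
    (fun n => Snotle _ _ (hsθ (n+1)) (hsθ n) (hsS n)) (fun x hx => hinit x hx.1 hx.2) ha1
  exact no_frame hL hsat hfew hMT a π hπ hk nat H

end PaperDef
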